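/- arXiv:1201.5219 — 2 statements merged into one kernel-verified Lean document; each statement's English description precedes it below -/
import Mathlib

section
/- Let M be a stationary random measure on ℝ admitting a moment of order 1+δ for some δ > 0 (i.e., E[M(K)^{1+δ}] < ∞ for compact K). Then there exists a nonnegative random variable Y ∈ L^{1+δ} such that for every bounded interval I ⊂ ℝ, (1/T) M(T·I) → Y·|I| almost surely and in L^{1+δ} as T → ∞, where |I| is the Lebesgue measure of I. -/
open MeasureTheory Filter Set

/-- The running maximum `max_{1 ≤ k ≤ n + 1} S_k φ` of the Birkhoff sums of `φ` along `T`,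
in recursive form. -/
noncomputable def birkhoffMax {α : Type*} (T : α → α) (φ : α → ℝ) : ℕ → α → ℝ
  | 0 => φ
  | n + 1 => fun x => φ x + max 0 (birkhoffMax T φ n (T x))

section Birkhoff

variable {α : Type*} {T : α → α} {φ : α → ℝ}

theorem birkhoffMax_succ (n : ℕ) (x : α) :
    birkhoffMax T φ (n + 1) x = φ x + max 0 (birkhoffMax T φ n (T x)) :=
  rfl

theorem birkhoffMax_le_succ (n : ℕ) (x : α) :
    birkhoffMax T φ n x ≤ birkhoffMax T φ (n + 1) x := by
  induction n generalizing x with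
  | zero => simp [birkhoffMax]
  | succ n ih =>
    rw [birkhoffMax_succ, birkhoffMax_succ (n + 1)]
    exact add_le_add_right (max_le_max le_rfl (ih _)) _

theorem monotone_birkhoffMax (x : α) : Monotone fun n => birkhoffMax T φ n x :=
  monotone_nat_of_le_succ fun n => birkhoffMax_le_succ n x

theorem birkhoffSum_succ_le_birkhoffMax (n : ℕ) (x : α) :
    birkhoffSum T φ (n + 1) x ≤ birkhoffMax T φ n x := by
  induction n generalizing x with
  | zero => simp [birkhoffMax]
  | succ n ih =>
    rw [birkhoffSum_succ', birkhoffMax_succ]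
    exact add_le_add_right ((ih _).trans (le_max_right _ _)) _

variable [MeasurableSpace α] {μ : Measure α}

theorem measurable_birkhoffMax (hT : Measurable T) (hφ : Measurable φ) (n : ℕ) :
    Measurable (birkhoffMax T φ n) := by
  induction n with
  | zero => exact hφ
  | succ n ih => exact hφ.add (measurable_const.max (ih.comp hT))

theorem MeasureTheory.MeasurePreserving.integrable_birkhoffMax (hT : MeasurePreserving T μ μ)
    (hφ : Integrable φ μ) (n : ℕ) : Integrable (birkhoffMax T φ n) μ := by
  induction n with
  | zero => exact hφ
  | succ n ih =>
    refine hφ.add ((hT.integrable_comp_of_integrable ih).pos_part.congr (ae_of_all _ fun x => ?_))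
    exact max_comm _ _

/-- The set where the Birkhoff sums of `φ` have unbounded running maximum. -/
def birkhoffMaxUnbounded (T : α → α) (φ : α → ℝ) : Set α :=
  {x | ∀ C : ℕ, ∃ n, (C : ℝ) < birkhoffMax T φ n x}

theorem measurableSet_invariants_birkhoffMaxUnbounded (hT : Measurable T) (hφ : Measurable φ) :
    MeasurableSet[MeasurableSpace.invariants T] (birkhoffMaxUnbounded T φ) := by
  refine ⟨?_, ?_⟩
  · simp only [birkhoffMaxUnbounded, ofPred_forall, ofPred_exists]
    exact .iInter fun C => .iUnion fun n =>
      measurableSet_lt measurable_const (measurable_birkhoffMax hT hφ n)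
  · ext x
    simp only [birkhoffMaxUnbounded, mem_preimage, mem_ofPred_eq]
    constructor
    · intro h C
      obtain ⟨C', hC'⟩ := exists_nat_gt (C - φ x)
      obtain ⟨n, hn⟩ := h C'
      refine ⟨n + 1, ?_⟩
      rw [birkhoffMax]
      linarith [le_max_right 0 (birkhoffMax T φ n (T x))]
    · intro h C
      obtain ⟨C', hC'⟩ := exists_nat_gt (C + |φ x|)
      obtain ⟨n, hn⟩ := h C'
      refine ⟨n, ?_⟩
      have h1 := birkhoffMax_le_succ (T := T) (φ := φ) n x
      rw [birkhoffMax] at h1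
      by_contra! hle
      have : max 0 (birkhoffMax T φ n (T x)) ≤ C := max_le (Nat.cast_nonneg C) hle
      linarith [le_abs_self (φ x)]

theorem MeasureTheory.MeasurePreserving.setIntegral_comp_of_preimage_eq
    (hT : MeasurePreserving T μ μ) {A : Set α} (hA : MeasurableSet A) (hTA : T ⁻¹' A = A)
    {g : α → ℝ} (hg : AEStronglyMeasurable g μ) :
    ∫ x in A, g (T x) ∂μ = ∫ x in A, g x ∂μ := by
  have h := hT.restrict_preimage hA
  rw [hTA] at h
  rw [← integral_map h.measurable.aemeasurable (by rw [h.map_eq]; exact hg.restrict), h.map_eq]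

/-- A form of the maximal ergodic theorem. -/
theorem MeasureTheory.MeasurePreserving.setIntegral_birkhoffMaxUnbounded_nonneg
    (hT : MeasurePreserving T μ μ) (hφm : Measurable φ) (hφ : Integrable φ μ) :
    0 ≤ ∫ x in birkhoffMaxUnbounded T φ, φ x ∂μ := by
  obtain ⟨hA, hTA⟩ := measurableSet_invariants_birkhoffMaxUnbounded hT.measurable hφm
  set A := birkhoffMaxUnbounded T φ
  have hint := hT.integrable_birkhoffMax hφ
  have hcomp : ∀ n, Integrable (fun x => birkhoffMax T φ n (T x)) μ := fun n =>
    hT.integrable_comp_of_integrable (hint n)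
  have hneg : ∀ n, Integrable (fun x => max 0 (-birkhoffMax T φ n (T x))) μ := fun n =>
    (hcomp n).neg_part.congr
      (ae_of_all _ fun x => max_comm _ _)
  have hadd : ∀ n, Integrable (fun x => φ x + max 0 (-birkhoffMax T φ n (T x))) μ := fun n =>
    hφ.add (hneg n)
  have hstep : ∀ n, 0 ≤ ∫ x in A, φ x ∂μ + ∫ x in A, max 0 (-birkhoffMax T φ n (T x)) ∂μ := by
    intro n
    have h1 : ∫ x in A, birkhoffMax T φ n x ∂μ ≤ ∫ x in A, birkhoffMax T φ (n + 1) x ∂μ :=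
      integral_mono (hint n).integrableOn (hint (n + 1)).integrableOn
        fun x => birkhoffMax_le_succ n x
    have h2 : ∫ x in A, birkhoffMax T φ (n + 1) x ∂μ = ∫ x in A, φ x ∂μ
        + ∫ x in A, max 0 (-birkhoffMax T φ n (T x)) ∂μ
        + ∫ x in A, birkhoffMax T φ n (T x) ∂μ := by
      rw [← integral_add hφ.integrableOn (hneg n).integrableOn,
        ← integral_add (hadd n).integrableOn (hcomp n).integrableOn]
      refine integral_congr_ae (ae_of_all _ fun x => ?_)
      simp only [birkhoffMax]
      rcases le_total 0 (birkhoffMax T φ n (T x)) with h | h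
      · rw [max_eq_right h, max_eq_left (by linarith)]; ring
      · rw [max_eq_left h, max_eq_right (by linarith)]; ring
    rw [hT.setIntegral_comp_of_preimage_eq hA hTA (hint n).1] at h2
    linarith
  have hlim : Tendsto (fun n => ∫ x in A, max 0 (-birkhoffMax T φ n (T x)) ∂μ) atTop
      (nhds (∫ _ in A, (0 : ℝ) ∂μ)) := by
    refine tendsto_integral_of_dominated_convergence (fun x => |φ (T x)|)
      (fun n => (hneg n).1.restrict)
      (hT.integrable_comp_of_integrable hφ).abs.integrableOn (fun n => ae_of_all _ fun x => ?_)
      ((ae_restrict_iff' hA).2 (ae_of_all _ fun x hx => ?_))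
    · rw [Real.norm_of_nonneg (le_max_left _ _)]
      refine max_le (abs_nonneg _) ?_
      have := monotone_birkhoffMax (T := T) (φ := φ) (T x) (Nat.zero_le n)
      simp only [birkhoffMax] at this
      linarith [neg_abs_le (φ (T x))]
    · rw [← hTA] at hx
      obtain ⟨N, hN⟩ := hx 0
      refine tendsto_const_nhds.congr' ?_
      filter_upwards [eventually_ge_atTop N] with n hn
      have := monotone_birkhoffMax (T := T) (φ := φ) (T x) hn
      simp only [Nat.cast_zero] at this hN
      rw [max_eq_left (by linarith)]
  rw [integral_zero] at hlim
  simpa using ge_of_tendsto' (hlim.const_add (∫ x in A, φ x ∂μ)) hstep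

theorem MeasureTheory.MeasurePreserving.ae_eventually_birkhoffAverage_le [IsFiniteMeasure μ]
    (hT : MeasurePreserving T μ μ) (hφm : Measurable φ) (hφ : Integrable φ μ) {ε : ℝ}
    (hε : 0 < ε) :
    ∀ᵐ x ∂μ, ∀ᶠ n in atTop,
      birkhoffAverage ℝ T φ n x ≤ (μ[φ | MeasurableSpace.invariants T]) x + ε := by
  set Y := μ[φ | MeasurableSpace.invariants T]
  have hle := MeasurableSpace.invariants_le T
  have hYm : Measurable[MeasurableSpace.invariants T] Y := stronglyMeasurable_condExp.measurable
  have hYinv : Y ∘ T = Y := MeasurableSpace.comp_eq_of_measurable_invariants hYm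
  have hYi : Integrable Y μ := integrable_condExp
  let ψ : α → ℝ := φ - (Y + fun _ => ε / 2)
  have hψm : Measurable ψ := hφm.sub ((hYm.mono hle le_rfl).add measurable_const)
  have hψ : Integrable ψ μ := hφ.sub (hYi.add (integrable_const _))
  have hA := measurableSet_invariants_birkhoffMaxUnbounded hT.measurable hψm
  have hpos := hT.setIntegral_birkhoffMaxUnbounded_nonneg hψm hψ
  have hval : ∫ x in birkhoffMaxUnbounded T ψ, ψ x ∂μ
      = -(μ.real (birkhoffMaxUnbounded T ψ) * (ε / 2)) := by
    change ∫ x in birkhoffMaxUnbounded T ψ, φ x - (Y + fun _ => ε / 2 : α → ℝ) x ∂μ = _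
    rw [integral_sub hφ.integrableOn (hYi.add (integrable_const _)).integrableOn,
      integral_add' hYi.integrableOn (integrable_const _), setIntegral_condExp hle hφ hA]
    simp
  have hnull : μ (birkhoffMaxUnbounded T ψ) = 0 := by
    have h0 : μ.real (birkhoffMaxUnbounded T ψ) = 0 := by
      have := measureReal_nonneg (μ := μ) (s := birkhoffMaxUnbounded T ψ)
      nlinarith
    exact (measureReal_eq_zero_iff).1 h0
  filter_upwards [measure_eq_zero_iff_ae_notMem.1 hnull] with x hx
  simp only [birkhoffMaxUnbounded, mem_ofPred_eq, not_forall, not_exists, not_lt] at hx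
  obtain ⟨C, hC⟩ := hx
  obtain ⟨N, hN⟩ := exists_nat_gt (C / (ε / 2))
  filter_upwards [eventually_ge_atTop (N + 1)] with n hn
  obtain ⟨k, rfl⟩ : ∃ k, n = k + 1 := ⟨n - 1, by omega⟩
  have h1 := (birkhoffSum_succ_le_birkhoffMax (T := T) (φ := ψ) k x).trans (hC k)
  have hinv : (Y + fun _ => ε / 2) ∘ T = Y + fun _ => ε / 2 := by
    rw [Pi.add_comp, hYinv]; rfl
  rw [birkhoffSum_sub, birkhoffSum_of_comp_eq hinv] at h1
  simp only [Pi.smul_apply, Pi.add_apply, nsmul_eq_mul] at h1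
  have hk : (0 : ℝ) < (k + 1 : ℕ) := by positivity
  rw [div_lt_iff₀ (by positivity)] at hN
  have hNk : (N : ℝ) ≤ (k + 1 : ℕ) := by exact_mod_cast (by omega : N ≤ k + 1)
  rw [birkhoffAverage, smul_eq_mul, inv_mul_le_iff₀ hk]
  nlinarith

/-- **Birkhoff's pointwise ergodic theorem**. -/
theorem MeasureTheory.MeasurePreserving.ae_tendsto_birkhoffAverage [IsFiniteMeasure μ]
    (hT : MeasurePreserving T μ μ) (hφm : Measurable φ) (hφ : Integrable φ μ) :
    ∀ᵐ x ∂μ, Tendsto (fun n => birkhoffAverage ℝ T φ n x) atTop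
      (nhds ((μ[φ | MeasurableSpace.invariants T]) x)) := by
  have hup := ae_all_iff.2 fun k : ℕ =>
    hT.ae_eventually_birkhoffAverage_le hφm hφ (Nat.one_div_pos_of_nat (α := ℝ) (n := k))
  have hlow := ae_all_iff.2 fun k : ℕ =>
    hT.ae_eventually_birkhoffAverage_le hφm.neg hφ.neg (Nat.one_div_pos_of_nat (α := ℝ) (n := k))
  filter_upwards [hup, hlow, condExp_neg φ (MeasurableSpace.invariants T) (μ := μ)]
    with x h1 h2 h3
  rw [Metric.tendsto_atTop']
  intro ε hε
  obtain ⟨k, hk⟩ := exists_nat_one_div_lt hε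
  obtain ⟨N, hN⟩ := eventually_atTop.1 ((h1 k).and (h2 k))
  refine ⟨N, fun n hn => ?_⟩
  obtain ⟨ha, hb⟩ := hN n hn.le
  simp only [h3, birkhoffAverage_neg, Pi.neg_apply] at hb
  rw [Real.dist_eq, abs_lt]
  constructor <;> linarith

end Birkhoff

section Cumulative

open Topology

theorem Monotone.tendsto_div_atTop_of_nat {G : ℝ → ℝ} (hG : Monotone G) {y : ℝ}
    (h : Tendsto (fun n : ℕ => G n / n) atTop (𝓝 y)) :
    Tendsto (fun x => G x / x) atTop (𝓝 y) := by
  have hfloor : Tendsto (fun x : ℝ => (⌊x⌋₊ : ℝ) / x) atTop (𝓝 1) := tendsto_nat_floor_div_atTop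
  have hfloor' : Tendsto (fun x : ℝ => ((⌊x⌋₊ + 1 : ℕ) : ℝ) / x) atTop (𝓝 1) := by
    simpa [add_div] using hfloor.add tendsto_inv_atTop_zero
  have hlow := (h.comp (tendsto_nat_floor_atTop (α := ℝ))).mul hfloor
  have hup := (h.comp ((tendsto_add_atTop_nat 1).comp (tendsto_nat_floor_atTop (α := ℝ)))).mul
    hfloor'
  rw [mul_one] at hlow hup
  refine tendsto_of_tendsto_of_tendsto_of_le_of_le' hlow hup ?_ ?_
  · filter_upwards [eventually_ge_atTop 1] with x hx
    have hpos : (0 : ℝ) < ⌊x⌋₊ := by exact_mod_cast Nat.floor_pos.2 hx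
    simp only [Function.comp_apply]
    rw [div_mul_div_cancel₀ hpos.ne']
    gcongr
    exact hG (Nat.floor_le (by linarith))
  · filter_upwards [eventually_ge_atTop 1] with x hx
    have hpos : (0 : ℝ) < (⌊x⌋₊ + 1 : ℕ) := by positivity
    simp only [Function.comp_apply]
    rw [div_mul_div_cancel₀ hpos.ne']
    gcongr
    apply hG
    exact_mod_cast (Nat.lt_floor_add_one x).le

theorem tendsto_comp_affine_div_of_pos {G : ℝ → ℝ} {y : ℝ}
    (h : Tendsto (fun x => G x / x) atTop (𝓝 y)) {c : ℝ} (hc : 0 < c) (d : ℝ) :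
    Tendsto (fun T => G (T * c + d) / T) atTop (𝓝 (y * c)) := by
  have hu : Tendsto (fun T : ℝ => T * c + d) atTop atTop :=
    tendsto_atTop_add_const_right _ _ (tendsto_id.atTop_mul_const hc)
  have hratio : Tendsto (fun T : ℝ => (T * c + d) / T) atTop (𝓝 c) := by
    have : Tendsto (fun T : ℝ => c + d / T) atTop (𝓝 (c + 0)) :=
      tendsto_const_nhds.add (tendsto_const_nhds.div_atTop tendsto_id)
    rw [add_zero] at this
    refine this.congr' ?_
    filter_upwards [eventually_gt_atTop 0] with T hT
    field_simp
  refine ((h.comp hu).mul hratio).congr' ?_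
  filter_upwards [hu.eventually_gt_atTop 0] with T hT
  simp only [Function.comp_apply]
  rw [div_mul_div_cancel₀ hT.ne']

theorem Monotone.tendsto_comp_affine_div {G : ℝ → ℝ} (hG : Monotone G) {y : ℝ}
    (hpos : Tendsto (fun n : ℕ => G n / n) atTop (𝓝 y))
    (hneg : Tendsto (fun n : ℕ => -G (-n) / n) atTop (𝓝 y)) (c d : ℝ) :
    Tendsto (fun T => G (T * c + d) / T) atTop (𝓝 (y * c)) := by
  rcases lt_trichotomy c 0 with hc | rfl | hc
  · have hG' : Monotone fun x => -G (-x) := fun a b hab => neg_le_neg (hG (neg_le_neg hab))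
    have := (tendsto_comp_affine_div_of_pos (hG'.tendsto_div_atTop_of_nat hneg)
      (neg_pos.2 hc) (-d)).neg
    convert this using 2
    · rw [neg_div, neg_neg]; congr 2; ring
    · ring
  · simpa using tendsto_const_nhds.div_atTop tendsto_id
  · exact tendsto_comp_affine_div_of_pos (hG.tendsto_div_atTop_of_nat hpos) hc d

/-- The signed cumulative function of a measure on `ℝ`, normalised to vanish at the origin. -/
noncomputable def signedCumulative (ν : Measure ℝ) (x : ℝ) : ℝ :=
  ν.real (Ico 0 x) - ν.real (Ico x 0)

variable {ν : Measure ℝ} [IsLocallyFiniteMeasure ν]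

theorem measureReal_Ico_add_Ico {u v w : ℝ} (huv : u ≤ v) (hvw : v ≤ w) :
    ν.real (Ico u v) + ν.real (Ico v w) = ν.real (Ico u w) := by
  rw [← Ico_union_Ico_eq_Ico huv hvw, measureReal_union (Ico_disjoint_Ico_same) measurableSet_Ico
    measure_Ico_lt_top.ne measure_Ico_lt_top.ne]

theorem measureReal_Ico_eq_signedCumulative_sub {u v : ℝ} (huv : u ≤ v) :
    ν.real (Ico u v) = signedCumulative ν v - signedCumulative ν u := by
  unfold signedCumulative
  rcases le_total 0 u with hu | hu
  · rw [Ico_eq_empty_of_le hu, Ico_eq_empty_of_le (hu.trans huv),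
      ← measureReal_Ico_add_Ico hu huv]
    simp
  · rcases le_total 0 v with hv | hv
    · rw [Ico_eq_empty_of_le hu, Ico_eq_empty_of_le hv, ← measureReal_Ico_add_Ico hu hv]
      simp [add_comm]
    · rw [Ico_eq_empty_of_le hu, Ico_eq_empty_of_le hv, ← measureReal_Ico_add_Ico huv hv]
      simp

theorem monotone_signedCumulative : Monotone (signedCumulative ν) := fun u v huv => by
  rw [← sub_nonneg, ← measureReal_Ico_eq_signedCumulative_sub huv]
  exact measureReal_nonneg

theorem tendsto_measureReal_Icc_div {y : ℝ}
    (hpos : Tendsto (fun n : ℕ => signedCumulative ν n / n) atTop (𝓝 y))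
    (hneg : Tendsto (fun n : ℕ => -signedCumulative ν (-n) / n) atTop (𝓝 y))
    {a b : ℝ} (hab : a ≤ b) :
    Tendsto (fun T => ν.real (Icc (T * a) (T * b)) / T) atTop (𝓝 (y * (b - a))) := by
  have hlim : ∀ d, Tendsto
      (fun T => (signedCumulative ν (T * b + d) - signedCumulative ν (T * a)) / T) atTop
      (𝓝 (y * (b - a))) := fun d => by
    have := (monotone_signedCumulative.tendsto_comp_affine_div hpos hneg b d).sub
      (monotone_signedCumulative.tendsto_comp_affine_div hpos hneg a 0)
    simpa only [← sub_div, add_zero, ← mul_sub] using this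
  refine tendsto_of_tendsto_of_tendsto_of_le_of_le' (hlim 0) (hlim 1) ?_ ?_
  · filter_upwards [eventually_gt_atTop 0] with T hT
    have hle : T * a ≤ T * b := by gcongr
    rw [add_zero, ← measureReal_Ico_eq_signedCumulative_sub hle]
    gcongr
    · exact measure_Icc_lt_top.ne
    · exact Ico_subset_Icc_self
  · filter_upwards [eventually_gt_atTop 0] with T hT
    have hle : T * a ≤ T * b := by gcongr
    rw [← measureReal_Ico_eq_signedCumulative_sub (by linarith)]
    gcongr
    · exact measure_Ico_lt_top.ne
    · exact lt_add_one (T * b)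

end Cumulative

section Stationary

open Topology ENNReal ProbabilityTheory

theorem MeasurableSpace.invariants_eq_of_inverse {α : Type*} [MeasurableSpace α] {f g : α → α}
    (hfg : Function.LeftInverse f g) (hgf : Function.LeftInverse g f) :
    invariants f = invariants g := by
  ext s
  refine and_congr_right fun _ => ⟨fun h => ?_, fun h => ?_⟩
  · conv_lhs => rw [← h, ← preimage_comp, hfg.comp_eq_id, preimage_id]
  · conv_lhs => rw [← h, ← preimage_comp, hgf.comp_eq_id, preimage_id]

/-- Translation of measures on `ℝ`. -/
noncomputable def translateMeasure (t : ℝ) (ν : Measure ℝ) : Measure ℝ := ν.map (· + t)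

theorem measurable_translateMeasure (t : ℝ) : Measurable (translateMeasure t) :=
  Measure.measurable_map _ (measurable_add_const t)

theorem translateMeasure_translateMeasure (s t : ℝ) (ν : Measure ℝ) :
    translateMeasure s (translateMeasure t ν) = translateMeasure (t + s) ν := by
  rw [translateMeasure, translateMeasure, translateMeasure,
    Measure.map_map (measurable_add_const s) (measurable_add_const t)]
  congr 1
  ext x
  simp [add_assoc]

theorem translateMeasure_zero (ν : Measure ℝ) : translateMeasure 0 ν = ν := by
  simp [translateMeasure]

theorem translateMeasure_iterate (t : ℝ) (n : ℕ) (ν : Measure ℝ) :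
    (translateMeasure t)^[n] ν = translateMeasure (n * t) ν := by
  induction n with
  | zero => simp [translateMeasure_zero]
  | succ n ih =>
    rw [Function.iterate_succ_apply', ih, translateMeasure_translateMeasure]
    congr 1
    push_cast
    ring

theorem translateMeasure_real_Ico (t u v : ℝ) (ν : Measure ℝ) :
    (translateMeasure t ν).real (Ico u v) = ν.real (Ico (u - t) (v - t)) := by
  rw [translateMeasure, map_measureReal_apply (measurable_add_const t) measurableSet_Ico,
    preimage_add_const_Ico]

theorem measurable_measureReal {s : Set ℝ} (hs : MeasurableSet s) :
    Measurable fun ν : Measure ℝ => ν.real s :=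
  (Measure.measurable_coe hs).ennreal_toReal

theorem birkhoffSum_translateMeasure_neg_one (ν : Measure ℝ) [IsLocallyFiniteMeasure ν] (n : ℕ) :
    birkhoffSum (translateMeasure (-1)) (fun ν => ν.real (Ico 0 1)) n ν = signedCumulative ν n := by
  have h : ∀ k : ℕ, ((translateMeasure (-1))^[k] ν).real (Ico 0 1)
      = signedCumulative ν (k + 1 : ℕ) - signedCumulative ν k := fun k => by
    rw [translateMeasure_iterate, translateMeasure_real_Ico,
      ← measureReal_Ico_eq_signedCumulative_sub (by push_cast; linarith)]
    congr 2 <;> push_cast <;> ring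
  simp only [birkhoffSum, h]
  rw [Finset.sum_range_sub (fun k : ℕ => signedCumulative ν k)]
  simp [signedCumulative]

theorem birkhoffSum_translateMeasure_one (ν : Measure ℝ) [IsLocallyFiniteMeasure ν] (n : ℕ) :
    birkhoffSum (translateMeasure 1) (fun ν => ν.real (Ico 0 1)) n ν
      = signedCumulative ν 1 - signedCumulative ν (1 - n) := by
  have h : ∀ k : ℕ, ((translateMeasure 1)^[k] ν).real (Ico 0 1)
      = signedCumulative ν (1 - k) - signedCumulative ν (1 - (k + 1 : ℕ)) := fun k => by
    rw [translateMeasure_iterate, translateMeasure_real_Ico,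
      ← measureReal_Ico_eq_signedCumulative_sub (by push_cast; linarith)]
    congr 2 <;> push_cast <;> ring
  simp only [birkhoffSum, h]
  rw [Finset.sum_range_sub' (fun k : ℕ => signedCumulative ν (1 - k))]
  simp

variable {Q : Measure (Measure ℝ)} {p : ℝ}

theorem ae_isLocallyFiniteMeasure (hp : 0 < p)
    (hmom : ∀ K : Set ℝ, IsCompact K → ∫⁻ ν, (ν K) ^ p ∂Q < ⊤) :
    ∀ᵐ ν ∂Q, IsLocallyFiniteMeasure ν := by
  have h : ∀ n : ℕ, ∀ᵐ ν ∂Q, ν (Icc (-n) n) < ⊤ := fun n => by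
    filter_upwards [ae_lt_top ((Measure.measurable_coe measurableSet_Icc).pow_const p)
      (hmom (Icc (-n) n) isCompact_Icc).ne] with ν hν
    exact (ENNReal.rpow_lt_top_iff_of_pos hp).1 hν
  filter_upwards [ae_all_iff.2 h] with ν hν
  refine ⟨fun x => ?_⟩
  obtain ⟨n, hn⟩ := exists_nat_gt |x|
  rw [abs_lt] at hn
  exact ⟨Icc (-n) n, Icc_mem_nhds hn.1 hn.2, hν n⟩

theorem memLp_measureReal_Ico (hp : 0 < p)
    (hmom : ∀ K : Set ℝ, IsCompact K → ∫⁻ ν, (ν K) ^ p ∂Q < ⊤) (u v : ℝ) :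
    MemLp (fun ν : Measure ℝ => ν.real (Ico u v)) (ENNReal.ofReal p) Q := by
  refine ⟨(measurable_measureReal measurableSet_Ico).aestronglyMeasurable, ?_⟩
  rw [eLpNorm_lt_top_iff_lintegral_rpow_enorm_lt_top (by simpa using hp) ENNReal.ofReal_ne_top,
    ENNReal.toReal_ofReal hp.le]
  refine lt_of_le_of_lt (lintegral_mono fun ν => ?_) (hmom (Icc u v) isCompact_Icc)
  refine ENNReal.rpow_le_rpow ?_ hp.le
  rw [Real.enorm_of_nonneg measureReal_nonneg]
  exact ENNReal.ofReal_toReal_le.trans (measure_mono Ico_subset_Icc_self)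

variable [IsProbabilityMeasure Q]

/-- The limiting intensity of a stationary random measure. -/
theorem exists_ae_tendsto_measureReal_Icc_div (hp : 1 ≤ p)
    (hstat : ∀ t, MeasurePreserving (translateMeasure t) Q Q)
    (hmom : ∀ K : Set ℝ, IsCompact K → ∫⁻ ν, (ν K) ^ p ∂Q < ⊤) :
    ∃ Y : Measure ℝ → ℝ, Measurable Y ∧ (∀ ν, 0 ≤ Y ν) ∧ MemLp Y (ENNReal.ofReal p) Q ∧
      ∀ᵐ ν ∂Q, ∀ a b, a ≤ b →
        Tendsto (fun T => ν.real (Icc (T * a) (T * b)) / T) atTop (𝓝 (Y ν * (b - a))) := by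
  have hp0 : 0 < p := by linarith
  have hp1 : 1 ≤ ENNReal.ofReal p := by simpa using hp
  set f : Measure ℝ → ℝ := fun ν => ν.real (Ico 0 1) with hf
  have hfm : Measurable f := measurable_measureReal measurableSet_Ico
  have hfL : MemLp f (ENNReal.ofReal p) Q := memLp_measureReal_Ico hp0 hmom 0 1
  have hfi : Integrable f Q := hfL.integrable hp1
  have hinv : MeasurableSpace.invariants (translateMeasure 1)
      = MeasurableSpace.invariants (translateMeasure (-1)) :=
    MeasurableSpace.invariants_eq_of_inverse
      (fun ν => by rw [translateMeasure_translateMeasure, neg_add_cancel, translateMeasure_zero])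
      (fun ν => by rw [translateMeasure_translateMeasure, add_neg_cancel, translateMeasure_zero])
  set Z := Q[f | MeasurableSpace.invariants (translateMeasure (-1))]
  have hZm : Measurable Z :=
    stronglyMeasurable_condExp.measurable.mono (MeasurableSpace.invariants_le _) le_rfl
  have hZnn : 0 ≤ᵐ[Q] Z := condExp_nonneg (ae_of_all _ fun _ => measureReal_nonneg)
  have hZeq : (fun ν => max (Z ν) 0) =ᵐ[Q] Z := by
    filter_upwards [hZnn] with ν hν using max_eq_left hν
  refine ⟨fun ν => max (Z ν) 0, hZm.max measurable_const, fun ν => le_max_right _ _,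
    (hfL.condExp hp1).ae_eq hZeq.symm, ?_⟩
  have hfwd := (hstat (-1)).ae_tendsto_birkhoffAverage hfm hfi
  have hbwd := (hstat 1).ae_tendsto_birkhoffAverage hfm hfi
  rw [hinv] at hbwd
  filter_upwards [hZeq, ae_isLocallyFiniteMeasure hp0 hmom, hfwd, hbwd] with ν hν hfin h1 h2
  intro a b hab
  rw [hν]
  refine tendsto_measureReal_Icc_div (h1.congr fun n => ?_) ?_ hab
  · rw [birkhoffAverage, hf, birkhoffSum_translateMeasure_neg_one, smul_eq_mul, inv_mul_eq_div]
  · have hratio : Tendsto (fun n : ℕ => ((n + 1 : ℕ) : ℝ) / n) atTop (𝓝 1) := by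
      have : Tendsto (fun n : ℕ => 1 + 1 / (n : ℝ)) atTop (𝓝 (1 + 0)) :=
        tendsto_const_nhds.add tendsto_one_div_atTop_nhds_zero_nat
      rw [add_zero] at this
      refine this.congr' ?_
      filter_upwards [eventually_gt_atTop 0] with n hn
      have : (n : ℝ) ≠ 0 := by positivity
      push_cast
      field_simp
    have hconst : Tendsto (fun n : ℕ => signedCumulative ν 1 / (n : ℝ)) atTop (𝓝 0) :=
      tendsto_const_nhds.div_atTop tendsto_natCast_atTop_atTop
    have := ((h2.comp (tendsto_add_atTop_nat 1)).mul hratio).sub hconst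
    rw [mul_one, sub_zero] at this
    refine this.congr' ?_
    filter_upwards [eventually_gt_atTop 0] with n hn
    have hn' : (n : ℝ) ≠ 0 := by positivity
    have hn1 : ((n + 1 : ℕ) : ℝ) ≠ 0 := by positivity
    have harg : (1 : ℝ) - (n + 1 : ℕ) = -n := by push_cast; ring
    rw [Function.comp_apply, birkhoffAverage, hf, birkhoffSum_translateMeasure_one, smul_eq_mul,
      inv_mul_eq_div, harg, div_mul_div_cancel₀ hn1]
    ring

theorem unifIntegrable_measureReal_Ico (hp : 1 ≤ p)
    (hstat : ∀ t, MeasurePreserving (translateMeasure t) Q Q)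
    (hmom : ∀ K : Set ℝ, IsCompact K → ∫⁻ ν, (ν K) ^ p ∂Q < ⊤) :
    UnifIntegrable (fun (k : ℤ) (ν : Measure ℝ) => ν.real (Ico (k : ℝ) (k + 1)))
      (ENNReal.ofReal p) Q := by
  have hm : ∀ k : ℤ, Measurable fun ν : Measure ℝ => ν.real (Ico (k : ℝ) (k + 1)) :=
    fun k => measurable_measureReal measurableSet_Ico
  refine (MemLp.uniformIntegrable_of_identDistrib (j := 0) (by simpa using hp)
    ENNReal.ofReal_ne_top (memLp_measureReal_Ico (by linarith) hmom _ _) fun k => ?_).unifIntegrable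
  refine ⟨(hm k).aemeasurable, (hm 0).aemeasurable, ?_⟩
  conv_rhs => rw [← (hstat (-k)).map_eq, Measure.map_map (hm 0) (measurable_translateMeasure _)]
  congr 1
  ext ν
  simp [translateMeasure_real_Ico, add_comm]

theorem measureReal_Icc_le_sum (ν : Measure ℝ) [IsLocallyFiniteMeasure ν] (u v : ℝ) :
    ν.real (Icc u v) ≤ ∑ k ∈ Finset.Icc ⌊u⌋ ⌊v⌋, ν.real (Ico (k : ℝ) (k + 1)) := by
  refine le_trans (measureReal_mono ?_ ?_) (measureReal_biUnion_finset_le _ _)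
  · intro x hx
    simp only [mem_iUnion]
    exact ⟨⌊x⌋, Finset.mem_Icc.2 ⟨Int.floor_mono hx.1, Int.floor_mono hx.2⟩,
      Int.floor_le x, Int.lt_floor_add_one x⟩
  · exact ((measure_biUnion_lt_top (Finset.finite_toSet _)
      fun k _ => measure_Ico_lt_top)).ne

theorem unifIntegrable_measureReal_Icc_div (hp : 1 ≤ p)
    (hstat : ∀ t, MeasurePreserving (translateMeasure t) Q Q)
    (hmom : ∀ K : Set ℝ, IsCompact K → ∫⁻ ν, (ν K) ^ p ∂Q < ⊤) {a b : ℝ} (hab : a ≤ b)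
    {ι : Type*} {τ : ι → ℝ} (hτ : ∀ i, 1 ≤ τ i) :
    UnifIntegrable (fun i (ν : Measure ℝ) => ν.real (Icc (τ i * a) (τ i * b)) / τ i)
      (ENNReal.ofReal p) Q := by
  intro ε hε
  have hC : 0 < b - a + 2 := by linarith
  obtain ⟨η, hη, h⟩ := unifIntegrable_measureReal_Ico hp hstat hmom (div_pos hε hC)
  refine ⟨η, hη, fun i s hs hμs => ?_⟩
  have hT : 0 < τ i := by linarith [hτ i]
  have hab' : τ i * a ≤ τ i * b := by gcongr
  set J := Finset.Icc ⌊τ i * a⌋ ⌊τ i * b⌋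
  set X : ℤ → Measure ℝ → ℝ := fun k ν => ν.real (Ico (k : ℝ) (k + 1))
  have hcard : (J.card : ℝ) ≤ τ i * (b - a + 2) := by
    have h1 : ((J.card : ℤ) : ℝ) = ⌊τ i * b⌋ + 1 - ⌊τ i * a⌋ := by
      rw [Int.card_Icc_of_le _ _ (by linarith [Int.floor_mono hab'])]
      push_cast
      ring
    rw [Int.cast_natCast] at h1
    rw [h1]
    nlinarith [Int.floor_le (τ i * b), Int.lt_floor_add_one (τ i * a), hτ i]
  calc eLpNorm (s.indicator fun ν : Measure ℝ => ν.real (Icc (τ i * a) (τ i * b)) / τ i)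
        (ENNReal.ofReal p) Q
      ≤ eLpNorm ((τ i)⁻¹ • ∑ k ∈ J, s.indicator (X k)) (ENNReal.ofReal p) Q := by
        refine eLpNorm_mono_ae ?_
        filter_upwards [ae_isLocallyFiniteMeasure (by linarith) hmom] with ν hν
        by_cases hνs : ν ∈ s
        · simp only [indicator_of_mem hνs, Pi.smul_apply, Finset.sum_apply, smul_eq_mul]
          rw [Real.norm_of_nonneg (by positivity), Real.norm_of_nonneg (by positivity),
            inv_mul_eq_div]
          gcongr
          exact measureReal_Icc_le_sum ν _ _
        · simp [indicator_of_notMem hνs]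
    _ = ‖(τ i)⁻¹‖ₑ * eLpNorm (∑ k ∈ J, s.indicator (X k)) (ENNReal.ofReal p) Q :=
        eLpNorm_const_smul _ _ _ _
    _ ≤ ENNReal.ofReal (τ i)⁻¹ * ∑ k ∈ J, ENNReal.ofReal (ε / (b - a + 2)) := by
        rw [Real.enorm_of_nonneg (by positivity)]
        gcongr
        refine (eLpNorm_sum_le (fun k _ => ?_) (by simpa using hp)).trans
          (Finset.sum_le_sum fun k _ => h k s hs hμs)
        exact ((measurable_measureReal measurableSet_Ico).indicator hs).aestronglyMeasurable
    _ = ENNReal.ofReal ((τ i)⁻¹ * (J.card * (ε / (b - a + 2)))) := by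
        rw [Finset.sum_const, nsmul_eq_mul, ENNReal.ofReal_mul (by positivity),
          ENNReal.ofReal_mul (by positivity), ENNReal.ofReal_natCast]
    _ ≤ ENNReal.ofReal ε := by
        refine ENNReal.ofReal_le_ofReal ?_
        rw [inv_mul_le_iff₀ hT, mul_div_assoc', div_le_iff₀ hC]
        nlinarith

theorem integral_abs_rpow_eq_toReal_eLpNorm_rpow {α : Type*} [MeasurableSpace α] {μ : Measure α}
    {g : α → ℝ} (hg : AEStronglyMeasurable g μ) (hp : 0 < p) :
    ∫ x, |g x| ^ p ∂μ = (eLpNorm g (ENNReal.ofReal p) μ ^ p).toReal := by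
  rw [integral_eq_lintegral_of_nonneg_ae (ae_of_all _ fun x => by positivity)
    (hg.aemeasurable.abs.pow_const p).aestronglyMeasurable,
    eLpNorm_eq_lintegral_rpow_enorm_toReal (by simpa using hp) ENNReal.ofReal_ne_top,
    ENNReal.toReal_ofReal hp.le, ← ENNReal.rpow_mul, one_div_mul_cancel hp.ne', ENNReal.rpow_one]
  congr 2
  ext x
  rw [← ENNReal.ofReal_rpow_of_nonneg (abs_nonneg _) hp.le, ← Real.enorm_eq_ofReal_abs]

theorem tendsto_integral_abs_measureReal_Icc_div_sub_rpow (hp : 1 ≤ p)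
    (hstat : ∀ t, MeasurePreserving (translateMeasure t) Q Q)
    (hmom : ∀ K : Set ℝ, IsCompact K → ∫⁻ ν, (ν K) ^ p ∂Q < ⊤) {a b : ℝ} (hab : a ≤ b)
    {g : Measure ℝ → ℝ} (hg : MemLp g (ENNReal.ofReal p) Q)
    (hlim : ∀ᵐ ν ∂Q, Tendsto (fun T => ν.real (Icc (T * a) (T * b)) / T) atTop (𝓝 (g ν))) :
    Tendsto (fun T => ∫ ν, |ν.real (Icc (T * a) (T * b)) / T - g ν| ^ p ∂Q) atTop (𝓝 0) := by
  have hp0 : 0 < p := by linarith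
  have hm : ∀ T, AEStronglyMeasurable (fun ν : Measure ℝ => ν.real (Icc (T * a) (T * b)) / T) Q :=
    fun T => ((measurable_measureReal measurableSet_Icc).div_const T).aestronglyMeasurable
  refine tendsto_of_seq_tendsto fun u hu => ?_
  have hu' : Tendsto (fun n => max 1 (u n)) atTop atTop :=
    tendsto_atTop_mono (fun n => le_max_right _ _) hu
  have hLp := tendsto_Lp_finite_of_tendsto_ae (by simpa using hp) ENNReal.ofReal_ne_top
    (fun n => hm (max 1 (u n))) hg
    (unifIntegrable_measureReal_Icc_div hp hstat hmom hab fun n => le_max_left 1 (u n))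
    (hlim.mono fun ν hν => hν.comp hu')
  have hpow := (ENNReal.tendsto_toReal (ENNReal.zero_ne_top)).comp
    (((ENNReal.continuous_rpow_const (y := p)).tendsto' 0 0
      (ENNReal.zero_rpow_of_pos hp0)).comp hLp)
  rw [ENNReal.toReal_zero] at hpow
  refine hpow.congr' ?_
  filter_upwards [hu.eventually_ge_atTop 1] with n hn
  simp only [Function.comp_apply, max_eq_right hn]
  exact (integral_abs_rpow_eq_toReal_eLpNorm_rpow ((hm (u n)).sub hg.1) hp0).symm

end Stationary

/-- Ergodic theorem for stationary random measures (Lemma 27): if `M` is a stationary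
random measure on `ℝ` with a moment of order `1+δ`, there is a nonnegative random variable
`Y ∈ L^{1+δ}` such that for every bounded interval `I`, `(1/T) M(T·I) → Y·|I|`
almost surely and in `L^{1+δ}` as `T → ∞`. -/
theorem stmt_5 {Ω : Type*} [MeasurableSpace Ω] (P : Measure Ω) [IsProbabilityMeasure P]
    (δ : ℝ) (hδ : 0 < δ)
    (M : Ω → Measure ℝ) (hM : Measurable M)
    (hstat : ∀ t : ℝ,
      Measure.map (fun ω => (M ω).map (· + t)) P = Measure.map M P)
    (hmom : ∀ K : Set ℝ, IsCompact K →
      ∫⁻ ω, (M ω K) ^ ((1 : ℝ) + δ) ∂P < ⊤) :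
    ∃ Y : Ω → ℝ, Measurable Y ∧ (∀ ω, 0 ≤ Y ω) ∧
      Integrable (fun ω => Y ω ^ ((1 : ℝ) + δ)) P ∧
      ∀ a b : ℝ, a ≤ b →
        (∀ᵐ ω ∂P,
          Tendsto (fun T : ℝ => (M ω ((T * ·) '' Set.Icc a b)).toReal / T)
            atTop (nhds (Y ω * (b - a)))) ∧
        Tendsto
          (fun T : ℝ =>
            ∫ ω, |(M ω ((T * ·) '' Set.Icc a b)).toReal / T - Y ω * (b - a)| ^ ((1 : ℝ) + δ) ∂P)
          atTop (nhds 0) := by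
  have hp : 1 ≤ 1 + δ := by linarith
  have hp0 : 0 < 1 + δ := by linarith
  have : IsProbabilityMeasure (P.map M) := Measure.isProbabilityMeasure_map hM.aemeasurable
  have hstatQ : ∀ t, MeasurePreserving (translateMeasure t) (P.map M) (P.map M) := fun t =>
    ⟨measurable_translateMeasure t,
      (Measure.map_map (measurable_translateMeasure t) hM).trans (hstat t)⟩
  have hmomQ : ∀ K : Set ℝ, IsCompact K → ∫⁻ ν, (ν K) ^ (1 + δ) ∂(P.map M) < ⊤ := fun K hK => by
    rw [lintegral_map ((Measure.measurable_coe hK.measurableSet).pow_const _) hM]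
    exact hmom K hK
  obtain ⟨Y, hYm, hYnn, hYL, hY⟩ := exists_ae_tendsto_measureReal_Icc_div hp hstatQ hmomQ
  refine ⟨Y ∘ M, hYm.comp hM, fun ω => hYnn _, ?_, fun a b hab => ?_⟩
  · have h := (hYL.comp_of_map hM.aemeasurable).integrable_norm_rpow
      (by simpa using hp0) ENNReal.ofReal_ne_top
    rw [ENNReal.toReal_ofReal hp0.le] at h
    refine h.congr (ae_of_all _ fun ω => ?_)
    simp only [Real.norm_of_nonneg (hYnn _), Function.comp_apply]
  · have hae : ∀ᵐ ν ∂(P.map M), Tendsto (fun T => ν.real (Icc (T * a) (T * b)) / T) atTop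
        (nhds (Y ν * (b - a))) := hY.mono fun ν hν => hν a b hab
    constructor
    · filter_upwards [ae_of_ae_map hM.aemeasurable hae] with ω hω
      refine hω.congr' ?_
      filter_upwards [eventually_gt_atTop 0] with T hT
      rw [image_mul_left_Icc hT.le hab, Measure.real]
    · refine (tendsto_integral_abs_measureReal_Icc_div_sub_rpow hp hstatQ hmomQ hab
        (hYL.mul_const (b - a)) hae).congr' ?_
      filter_upwards [eventually_gt_atTop 0] with T hT
      rw [integral_map hM.aemeasurable]
      · simp only [image_mul_left_Icc hT.le hab, Measure.real, Function.comp_apply]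
      · have := ((measurable_measureReal (s := Icc (T * a) (T * b)) measurableSet_Icc).div_const
          T).sub (hYm.mul_const (b - a))
        exact (this.abs.pow_const _).aestronglyMeasurable
end

section
/- Let (ω_ε)_{ε∈(0,1]} be a family of stationary stochastically continuous processes on ℝ^d such that for all ε, ε' ∈ (0,1], (ω_{εε'}(x))_x equals in law (ω_ε(x) + ω̃_{ε'}(x/ε))_x with ω̃_{ε'} an independent copy of ω_{ε'}, and assume ε ↦ ω_ε(x) is continuous in distribution. Then for each fixed ε and each finite set of points x_1, …, x_n, the random vector (ω_ε(x_1), …, ω_ε(x_n)) is infinitely divisible. -/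
open MeasureTheory Filter Set
open scoped MeasureTheory

/-- A probability measure `μ` on an additive group is infinitely divisible if for every
`k ≥ 1` it is the `k`-fold convolution of some probability measure. -/
def IsInfinitelyDivisible {E : Type*} [MeasurableSpace E] [AddMonoid E] [MeasurableAdd₂ E]
    (μ : Measure E) : Prop :=
  ∀ k : ℕ, 0 < k → ∃ ν : Measure E, IsProbabilityMeasure ν ∧
    μ = (fun ρ : Measure E => ρ ∗ ν)^[k] (Measure.dirac 0)

open Topology

/-- Rounding: a fraction `θ` of a finite sum of vectors of norm at most `δ` is a partial sum up to
an error of at most `dim V * δ`. -/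
lemma exists_finset_norm_sum_sub_smul_sum_le {V ι : Type*} [NormedAddCommGroup V]
    [NormedSpace ℝ V] [FiniteDimensional ℝ V] [Fintype ι] (v : ι → V) {δ θ : ℝ} (hδ : 0 ≤ δ)
    (hv : ∀ j, ‖v j‖ ≤ δ) (hθ : θ ∈ Icc (0 : ℝ) 1) :
    ∃ S : Finset ι, ‖∑ j ∈ S, v j - θ • ∑ j, v j‖ ≤ Module.finrank ℝ V * δ := by
  classical
  set A : Set (ι → ℝ) :=
    Set.univ.pi (fun _ => Icc (0 : ℝ) 1) ∩ {w | ∑ j, w j • v j = θ • ∑ j, v j} with hA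
  have hcomp : IsCompact A :=
    (isCompact_univ_pi fun _ => isCompact_Icc).inter_right
      (isClosed_eq (by fun_prop) continuous_const)
  have hne : A.Nonempty := ⟨fun _ => θ, fun _ _ => hθ, by simp [Finset.smul_sum]⟩
  obtain ⟨w, hw⟩ := hcomp.extremePoints_nonempty hne
  rw [mem_extremePoints_iff_left] at hw
  obtain ⟨⟨hw01, hwsum⟩, hext⟩ := hw
  simp only [Set.mem_pi, Set.mem_univ, true_implies] at hw01
  simp only [Set.mem_ofPred_eq] at hwsum
  set F : Finset ι := {j | w j ≠ 0 ∧ w j ≠ 1} with hF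
  have hcard : F.card ≤ Module.finrank ℝ V := by
    by_contra! hlt
    have hdep : ¬ LinearIndependent ℝ (fun j : F => v j) := fun h => by
      have := h.fintype_card_le_finrank
      simp at this
      omega
    obtain ⟨g, hg, z, hz⟩ := Fintype.not_linearIndependent_iff.mp hdep
    let c : ι → ℝ := fun j => if h : j ∈ F then g ⟨j, h⟩ else 0
    have hc : ∑ j, c j • v j = 0 := by
      rw [← hg, Finset.sum_coe_sort_eq_attach,
        ← Finset.sum_subset (Finset.subset_univ F) (fun j _ hj => by simp [c, hj]),
        ← Finset.sum_attach]
      exact Finset.sum_congr rfl fun j _ => by simp [c]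
    have hmem : ∀ᶠ s : ℝ in 𝓝 0, ∀ j, w j + s * c j ∈ Icc (0 : ℝ) 1 := by
      refine eventually_all.2 fun j => ?_
      by_cases hj : j ∈ F
      · have hj' : w j ≠ 0 ∧ w j ≠ 1 := by simpa [hF] using hj
        have hIoo : Ioo (0 : ℝ) 1 ∈ 𝓝 (w j + 0 * c j) := by
          apply Ioo_mem_nhds
          · simpa using lt_of_le_of_ne (hw01 j).1 (Ne.symm hj'.1)
          · simpa using lt_of_le_of_ne (hw01 j).2 hj'.2
        have hcont : ContinuousAt (fun s : ℝ => w j + s * c j) 0 := by fun_prop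
        exact (hcont.eventually hIoo).mono fun s hs => Ioo_subset_Icc_self hs
      · simp only [c, hj, dite_false, mul_zero, add_zero]
        exact Eventually.of_forall fun _ => hw01 j
    obtain ⟨r, hr, hball⟩ := Metric.eventually_nhds_iff.1 hmem
    have hin : ∀ s : ℝ, |s| < r → (fun j => w j + s * c j) ∈ A := fun s hs =>
      ⟨fun j _ => hball (by simpa using hs) j, by
        simp only [Set.mem_ofPred_eq, add_smul, Finset.sum_add_distrib, mul_smul,
          ← Finset.smul_sum, hc, hwsum]
        simp⟩
    have hr2 : |r / 2| < r := by rw [abs_of_pos (by linarith)]; linarith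
    have heq := hext _ (hin (r / 2) hr2) _ (hin (-(r / 2)) (by rwa [abs_neg]))
      ⟨1 / 2, 1 / 2, by norm_num, by norm_num, by norm_num, by
        ext j; simp only [Pi.add_apply, Pi.smul_apply, smul_eq_mul]; ring⟩
    have hz' := congrFun heq z
    simp only [c, z.2, dite_true, Subtype.coe_eta, add_eq_left, mul_eq_zero, hz, or_false] at hz'
    linarith
  refine ⟨Finset.univ.filter fun j => w j = 1, ?_⟩
  have hsplit : ∑ j, w j • v j = ∑ j with w j = 1, v j + ∑ j ∈ F, w j • v j := by
    rw [Finset.sum_filter, hF, Finset.sum_filter, ← Finset.sum_add_distrib]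
    refine Finset.sum_congr rfl fun j _ => ?_
    by_cases h1 : w j = 1
    · simp [h1]
    · by_cases h0 : w j = 0 <;> simp [h0, h1]
  rw [← hwsum, hsplit, sub_add_cancel_left, norm_neg]
  calc ‖∑ j ∈ F, w j • v j‖ ≤ ∑ j ∈ F, ‖w j • v j‖ := norm_sum_le _ _
    _ ≤ ∑ _j ∈ F, δ := Finset.sum_le_sum fun j _ => by
        rw [norm_smul, Real.norm_of_nonneg (hw01 j).1]
        exact (mul_le_of_le_one_left (norm_nonneg _) (hw01 j).2).trans (hv j)
    _ = F.card * δ := by simp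
    _ ≤ Module.finrank ℝ V * δ := by
        gcongr

lemma abs_im_sub_le_of_norm_exp_mul_exp_sub_one_lt {g : ℝ → ℂ} (hg : ContinuousOn g (Icc 0 1))
    (hg0 : g 0 = 0) (a : ℝ)
    (h : ∀ s ∈ Icc (0 : ℝ) 1,
      ‖Complex.exp (g s) * Complex.exp (-(((s * a : ℝ) : ℂ) * Complex.I)) - 1‖ < 1) :
    |(g 1).im - a| ≤ Real.pi / 2 := by
  set f : ℝ → ℝ := fun s => (g s).im - s * a with hf
  have hfc : ContinuousOn f (Icc 0 1) := by
    have := Complex.continuous_im.comp_continuousOn hg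
    exact this.sub (by fun_prop)
  have hcos : ∀ s ∈ Icc (0 : ℝ) 1, 0 < Real.cos (f s) := by
    intro s hs
    have h1 := (Complex.abs_re_le_norm _).trans_lt (h s hs)
    rw [← Complex.exp_add, Complex.sub_re, Complex.exp_re, Complex.one_re, abs_lt] at h1
    have h2 : 0 < Real.exp (g s + -(((s * a : ℝ) : ℂ) * Complex.I)).re *
      Real.cos (g s + -(((s * a : ℝ) : ℂ) * Complex.I)).im := by linarith
    have h3 := pos_of_mul_pos_right h2 (Real.exp_pos _).le
    simpa [hf, sub_eq_add_neg] using h3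
  have hf0 : f 0 = 0 := by simp [hf, hg0]
  have hf1 : f 1 = (g 1).im - a := by simp [hf]
  rw [← hf1]
  by_contra! hlt
  have habs : ContinuousOn (fun s => |f s|) (Icc 0 1) := hfc.abs
  obtain ⟨s, hs, hs'⟩ := intermediate_value_Icc zero_le_one habs
    (show Real.pi / 2 ∈ Icc |f 0| |f 1| from ⟨by simp [hf0]; positivity, hlt.le⟩)
  have := hcos s hs
  rw [← Real.cos_abs, show |f s| = Real.pi / 2 from hs', Real.cos_pi_div_two] at this
  exact lt_irrefl _ this

lemma norm_charFunDual_mul_exp_sub_one_le {E : Type*} [NormedAddCommGroup E] [NormedSpace ℝ E]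
    [MeasurableSpace E] [BorelSpace E] (ν : Measure E) [IsProbabilityMeasure ν]
    (L : StrongDual ℝ E) (c : E) {R : ℝ} (hR : 0 ≤ R) :
    ‖charFunDual ν L * Complex.exp (-((L c : ℝ) * Complex.I)) - 1‖ ≤
      ‖L‖ * R + 2 * ν.real (Metric.closedBall c R)ᶜ := by
  have hint : Integrable (fun x => Complex.exp (L x * Complex.I)) ν :=
    Integrable.of_bound (by fun_prop) 1 (Eventually.of_forall fun x => by
      simp [Complex.norm_exp_ofReal_mul_I])
  have heq : charFunDual ν L * Complex.exp (-((L c : ℝ) * Complex.I)) - 1 =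
      ∫ x, (Complex.exp (Complex.I * (L (x - c) : ℝ)) - 1) ∂ν := by
    rw [charFunDual_apply, ← integral_mul_const]
    have : (1 : ℂ) = ∫ _x, (1 : ℂ) ∂ν := by simp
    nth_rw 1 [this]
    rw [← integral_sub (hint.mul_const _) (integrable_const _)]
    congr 1; ext x
    rw [← Complex.exp_add, map_sub]
    congr 2; push_cast; ring
  have hms : MeasurableSet (Metric.closedBall c R)ᶜ :=
    Metric.isClosed_closedBall.measurableSet.compl
  rw [heq]
  calc ‖∫ x, (Complex.exp (Complex.I * (L (x - c) : ℝ)) - 1) ∂ν‖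
      ≤ ∫ x, (‖L‖ * R + (Metric.closedBall c R)ᶜ.indicator (fun _ => (2 : ℝ)) x) ∂ν := by
        refine norm_integral_le_of_norm_le
          ((integrable_const _).add ((integrable_const _).indicator hms))
          (Eventually.of_forall fun x => ?_)
        by_cases hx : x ∈ Metric.closedBall c R
        · rw [Set.indicator_of_notMem (by simpa using hx), add_zero]
          refine Real.norm_exp_I_mul_ofReal_sub_one_le.trans ((L.le_opNorm _).trans ?_)
          gcongr
          simpa [dist_eq_norm] using hx
        · rw [Set.indicator_of_mem (by simpa using hx)]
          have h2 : ‖Complex.exp (Complex.I * (L (x - c) : ℝ)) - 1‖ ≤ 1 + 1 := by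
            refine (norm_sub_le _ _).trans ?_
            rw [mul_comm, Complex.norm_exp_ofReal_mul_I, norm_one]
          nlinarith [mul_nonneg (norm_nonneg L) hR]
    _ = ‖L‖ * R + 2 * ν.real (Metric.closedBall c R)ᶜ := by
        rw [integral_add (integrable_const _) ((integrable_const _).indicator hms),
          integral_indicator_const _ hms]
        simp [mul_comm]

/-- If a measure of mass one is a convolution factor of `μ`, then up to one translation its tails
are controlled by those of `μ`. -/
lemma exists_center_of_conv_eq {E : Type*} [NormedAddCommGroup E] [MeasurableSpace E]
    [BorelSpace E] [SecondCountableTopology E] {μ ν ν' : Measure E}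
    [IsProbabilityMeasure μ] [IsProbabilityMeasure ν] [IsProbabilityMeasure ν']
    (h : ν' ∗ ν = μ) {R u : ℕ → ℝ} (hu : ∀ p, u p < 1 / 2)
    (hR : ∀ p, μ.real (Metric.closedBall 0 (R p))ᶜ ≤ u p) :
    ∃ c : E, ∀ p, ν.real (Metric.closedBall c (R 0 + 2 * R p))ᶜ ≤ u p := by
  have hms : ∀ (c : E) r, MeasurableSet (Metric.closedBall c r) :=
    fun c r => Metric.isClosed_closedBall.measurableSet
  have key : ∀ p, ∃ c : E, ν.real (Metric.closedBall c (R p))ᶜ ≤ u p := by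
    intro p
    have hμ : μ (Metric.closedBall 0 (R p))ᶜ =
        ∫⁻ x, ν (Metric.closedBall (-x) (R p))ᶜ ∂ν' := by
      rw [← h, ← lintegral_indicator_one (hms _ _).compl,
        Measure.lintegral_conv (measurable_one.indicator (hms _ _).compl)]
      congr 1; ext x
      rw [← lintegral_indicator_one (hms _ _).compl]
      congr 1; ext y
      have : x + y ∈ (Metric.closedBall (0 : E) (R p))ᶜ ↔
          y ∈ (Metric.closedBall (-x) (R p))ᶜ := by
        simp [dist_eq_norm, add_comm]
      by_cases hy : y ∈ (Metric.closedBall (-x) (R p))ᶜ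
      · rw [Set.indicator_of_mem hy, Set.indicator_of_mem (this.2 hy)]; rfl
      · rw [Set.indicator_of_notMem hy, Set.indicator_of_notMem (mt this.1 hy)]
    have hmeas : Measurable fun x => ν (Metric.closedBall (-x) (R p))ᶜ := by
      have hset : MeasurableSet {q : E × E | dist q.2 (-q.1) ≤ R p}ᶜ :=
        (measurableSet_le (by fun_prop) measurable_const).compl
      exact measurable_measure_prodMk_left hset
    obtain ⟨x, hx⟩ := exists_le_lintegral hmeas.aemeasurable (μ := ν')
    refine ⟨-x, le_trans ?_ (hR p)⟩
    rw [← hμ] at hx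
    exact ENNReal.toReal_mono (measure_ne_top _ _) hx
  choose c hc using key
  refine ⟨c 0, fun p => le_trans (measureReal_mono ?_) (hc p)⟩
  rw [Set.compl_subset_compl]
  have hinter : (Metric.closedBall (c 0) (R 0) ∩ Metric.closedBall (c p) (R p)).Nonempty := by
    by_contra hemp
    rw [Set.not_nonempty_iff_eq_empty] at hemp
    have h1 : (Set.univ : Set E) ⊆
        (Metric.closedBall (c 0) (R 0))ᶜ ∪ (Metric.closedBall (c p) (R p))ᶜ := by
      rw [← Set.compl_inter, hemp, Set.compl_empty]
    have h2 := (measureReal_mono (μ := ν) h1).trans (measureReal_union_le _ _)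
    rw [probReal_univ] at h2
    linarith [hc 0, hc p, hu 0, hu p]
  obtain ⟨z, hz0, hzp⟩ := hinter
  intro y hy
  rw [Metric.mem_closedBall] at *
  have h1 := dist_triangle4 y (c p) z (c 0)
  rw [dist_comm (c p) z] at h1
  linarith

lemma continuous_charFunDual_smul {E : Type*} [NormedAddCommGroup E] [NormedSpace ℝ E]
    [MeasurableSpace E] [BorelSpace E] (ν : Measure E) [IsFiniteMeasure ν]
    (L : StrongDual ℝ E) : Continuous fun s : ℝ => charFunDual ν (s • L) := by
  simp only [charFunDual_apply]
  refine continuous_of_dominated (bound := fun _ => 1) (fun s => by fun_prop)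
    (fun s => Eventually.of_forall fun x => ?_) (integrable_const _)
    (Eventually.of_forall fun x => ?_)
  · rw [Complex.norm_exp_ofReal_mul_I]
  · simp only [_root_.smul_apply]
    fun_prop

lemma continuous_charFunDual_probabilityMeasure {E : Type*} [NormedAddCommGroup E]
    [NormedSpace ℝ E] [MeasurableSpace E] [BorelSpace E] (L : StrongDual ℝ E) :
    Continuous fun ν : ProbabilityMeasure E => charFunDual (ν : Measure E) L := by
  rw [continuous_iff_continuousAt]
  intro ν
  exact (ProbabilityMeasure.tendsto_iff_forall_integral_rclike_tendsto ℂ).1 tendsto_id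
    (BoundedContinuousFunction.probCharDual L)

/-- The law of the sum over `S` of independent vectors with laws `ν j`. -/
noncomputable def sumLaw {ι E : Type*} [Fintype ι] [AddCommMonoid E] [MeasurableSpace E]
    (ν : ι → Measure E) (S : Finset ι) : Measure E :=
  (Measure.pi ν).map fun x => ∑ j ∈ S, x j

lemma isProbabilityMeasure_sumLaw {ι E : Type*} [Fintype ι] [AddCommMonoid E] [MeasurableSpace E]
    [MeasurableAdd₂ E] (ν : ι → Measure E) [∀ j, IsProbabilityMeasure (ν j)] (S : Finset ι) :
    IsProbabilityMeasure (sumLaw ν S) :=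
  Measure.isProbabilityMeasure_map (by fun_prop)

lemma charFunDual_sumLaw {ι E : Type*} [Fintype ι] [NormedAddCommGroup E] [NormedSpace ℝ E]
    [MeasurableSpace E] [BorelSpace E] [SecondCountableTopology E] (ν : ι → Measure E)
    [∀ j, IsProbabilityMeasure (ν j)] (S : Finset ι) (L : StrongDual ℝ E) :
    charFunDual (sumLaw ν S) L = ∏ j ∈ S, charFunDual (ν j) L := by
  classical
  rw [sumLaw, charFunDual_apply, integral_map (by fun_prop) (by fun_prop)]
  have h1 : ∀ x : ι → E, Complex.exp ((L (∑ j ∈ S, x j) : ℝ) * Complex.I) =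
      ∏ j, (fun y : E => if j ∈ S then Complex.exp ((L y : ℝ) * Complex.I) else 1) (x j) := by
    intro x
    simp only [Finset.prod_ite_mem, Finset.univ_inter]
    rw [map_sum, Complex.ofReal_sum, Finset.sum_mul, Complex.exp_sum]
  simp only [h1]
  rw [integral_fintype_prod_eq_prod
    (f := fun j (y : E) => if j ∈ S then Complex.exp ((L y : ℝ) * Complex.I) else 1)]
  have h2 : ∀ j, ∫ y, (if j ∈ S then Complex.exp ((L y : ℝ) * Complex.I) else 1) ∂(ν j) =
      if j ∈ S then charFunDual (ν j) L else 1 := by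
    intro j
    by_cases hj : j ∈ S <;> simp [hj, charFunDual_apply]
  simp [h2]

/-- The summands have characteristic functions close to one along the segment `[0, L]`, so that
the sum of their logarithms is a continuous logarithm of the characteristic function of the sum. -/
lemma abs_im_sum_log_sub_le {ι E : Type*} [NormedAddCommGroup E]
    [NormedSpace ℝ E] [MeasurableSpace E] [BorelSpace E]
    {ν : ι → Measure E} [∀ j, IsProbabilityMeasure (ν j)] {S : Finset ι} {κ : Measure E}
    {L : StrongDual ℝ E} {c : E}
    (hκ : ∀ L, charFunDual κ L = ∏ j ∈ S, charFunDual (ν j) L)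
    (hν : ∀ j, ∀ s ∈ Icc (0 : ℝ) 1, ‖charFunDual (ν j) (s • L) - 1‖ < 1)
    (hc : ∀ s ∈ Icc (0 : ℝ) 1,
      ‖charFunDual κ (s • L) * Complex.exp (-(((s • L) c : ℝ) * Complex.I)) - 1‖ < 1) :
    |(∑ j ∈ S, Complex.log (charFunDual (ν j) L)).im - L c| ≤ Real.pi / 2 := by
  have hslit : ∀ j, ∀ s ∈ Icc (0 : ℝ) 1, charFunDual (ν j) (s • L) ∈ Complex.slitPlane := by
    intro j s hs
    simpa using Complex.mem_slitPlane_of_norm_lt_one (hν j s hs)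
  have h := abs_im_sub_le_of_norm_exp_mul_exp_sub_one_lt
    (g := fun s : ℝ => ∑ j ∈ S, Complex.log (charFunDual (ν j) (s • L))) (a := L c) ?_ ?_ ?_
  · simpa using h
  · exact continuousOn_finsetSum _ fun j _ =>
      (continuous_charFunDual_smul (ν j) L).continuousOn.clog (hslit j)
  · simp [charFunDual_apply]
  · intro s hs
    have h1 := hc s hs
    rw [hκ] at h1
    rw [Complex.exp_sum, Finset.prod_congr rfl fun j _ =>
      Complex.exp_log (Complex.slitPlane_ne_zero (hslit j s hs))]
    simpa using h1

lemma charFunDual_iterate_conv {E : Type*} [NormedAddCommGroup E] [NormedSpace ℝ E]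
    [MeasurableSpace E] [BorelSpace E] [SecondCountableTopology E] (ν : Measure E)
    [IsProbabilityMeasure ν] (k : ℕ) :
    IsProbabilityMeasure ((fun ρ : Measure E => ρ ∗ ν)^[k] (Measure.dirac 0)) ∧
    ∀ L, charFunDual ((fun ρ : Measure E => ρ ∗ ν)^[k] (Measure.dirac 0)) L =
      charFunDual ν L ^ k := by
  induction k with
  | zero => exact ⟨by simp; infer_instance, fun L => by simp [charFunDual_dirac]⟩
  | succ k ih =>
    obtain ⟨h1, h2⟩ := ih
    rw [Function.iterate_succ_apply']
    exact ⟨inferInstance, fun L => by rw [charFunDual_conv, h2, pow_succ]⟩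

lemma exists_radii_measureReal_compl_closedBall_le {E : Type*} [NormedAddCommGroup E]
    [MeasurableSpace E] [BorelSpace E] (μ : Measure E) [IsFiniteMeasure μ] {u : ℕ → ℝ}
    (hu : ∀ p, 0 < u p) :
    ∃ R : ℕ → ℝ, ∀ p, 0 ≤ R p ∧ μ.real (Metric.closedBall 0 (R p))ᶜ ≤ u p := by
  have h : Tendsto (fun m : ℕ => μ.real (Metric.closedBall (0 : E) m)ᶜ) atTop (𝓝 0) := by
    have hinter : ⋂ m : ℕ, (Metric.closedBall (0 : E) m)ᶜ = ∅ := by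
      rw [← Set.compl_iUnion, Metric.iUnion_closedBall_nat, Set.compl_univ]
    have := tendsto_measure_iInter_atTop (μ := μ) (s := fun m : ℕ => (Metric.closedBall (0 : E) m)ᶜ)
      (fun m => Metric.isClosed_closedBall.measurableSet.compl.nullMeasurableSet)
      (fun a b hab => Set.compl_subset_compl.2 (Metric.closedBall_subset_closedBall (by simpa)))
      ⟨0, measure_ne_top _ _⟩
    rw [hinter, measure_empty] at this
    exact (ENNReal.tendsto_toReal ENNReal.zero_ne_top).comp this
  have h2 : ∀ p, ∃ r : ℝ, 0 ≤ r ∧ μ.real (Metric.closedBall 0 r)ᶜ ≤ u p := fun p => by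
    obtain ⟨m, hm⟩ := (h.eventually_le_const (hu p)).exists
    exact ⟨m, by positivity, hm⟩
  choose R hR using h2
  exact ⟨R, hR⟩

/-- For every `ρ > 0`, the measure `μ` is a finite convolution of probability measures giving mass
at most `ρ` to the complement of the ball of radius `ρ`. -/
def IsNullDecomposable {E : Type*} [NormedAddCommGroup E] [NormedSpace ℝ E] [MeasurableSpace E]
    (μ : Measure E) : Prop :=
  ∀ ρ : ℝ, 0 < ρ → ∃ (m : ℕ) (ν : Fin m → Measure E), (∀ j, IsProbabilityMeasure (ν j)) ∧
    (∀ j, (ν j).real (Metric.closedBall 0 ρ)ᶜ ≤ ρ) ∧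
    ∀ L, charFunDual μ L = ∏ j, charFunDual (ν j) L

/-- One can select some of the factors of a fine decomposition of `μ` so that, at finitely many
points, the logarithm of the characteristic function of their convolution is close to `k⁻¹` times
that of `μ`. -/
lemma IsNullDecomposable.exists_factor {E : Type*} [NormedAddCommGroup E] [NormedSpace ℝ E]
    [MeasurableSpace E] [BorelSpace E] [SecondCountableTopology E] [CompleteSpace E]
    {μ : Measure E} [IsProbabilityMeasure μ] (hμ : IsNullDecomposable μ) {k : ℕ} (hk : 0 < k)
    (F : Finset (StrongDual ℝ E)) {η : ℝ} (hη : 0 < η) :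
    ∃ (m : ℕ) (ν : Fin m → Measure E) (S : Finset (Fin m)), (∀ j, IsProbabilityMeasure (ν j)) ∧
      (∀ L, charFunDual μ L = ∏ j, charFunDual (ν j) L) ∧
      (∀ L ∈ F, ∀ j, ∀ s ∈ Icc (0 : ℝ) 1, ‖charFunDual (ν j) (s • L) - 1‖ < 1) ∧
      ∀ L ∈ F, ‖∑ j ∈ S, Complex.log (charFunDual (ν j) L) -
        (k : ℝ)⁻¹ • ∑ j, Complex.log (charFunDual (ν j) L)‖ ≤ η := by
  obtain ⟨U, hU0, hU⟩ : ∃ U : ℝ, 0 ≤ U ∧ ∀ L ∈ F, ‖L‖ ≤ U :=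
    ⟨∑ L ∈ F, ‖L‖, Finset.sum_nonneg fun _ _ => norm_nonneg _, fun L hL =>
      Finset.single_le_sum (f := fun L => ‖L‖) (fun _ _ => norm_nonneg _) hL⟩
  set D : ℝ := (Module.finrank ℝ (F → ℂ) : ℝ) with hD
  have hD0 : 0 ≤ D := Nat.cast_nonneg _
  set δ : ℝ := η / (D + 1) with hδdef
  have hδ : 0 < δ := by positivity
  have hDδ : D * δ ≤ η := by
    rw [hδdef, ← mul_div_assoc, div_le_iff₀ (by positivity)]
    nlinarith
  set τ : ℝ := min (1 / 2) (δ / 2) with hτ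
  have hτ0 : 0 < τ := by positivity
  obtain ⟨m, ν, hprob, hsmall, hprod⟩ := hμ (τ / (U + 2)) (by positivity)
  have hclose : ∀ L ∈ F, ∀ j, ∀ s ∈ Icc (0 : ℝ) 1, ‖charFunDual (ν j) (s • L) - 1‖ ≤ τ := by
    intro L hL j s hs
    have h1 := norm_charFunDual_mul_exp_sub_one_le (ν j) (s • L) 0
      (show 0 ≤ τ / (U + 2) by positivity)
    simp only [map_zero, Complex.ofReal_zero, zero_mul, neg_zero, Complex.exp_zero, mul_one] at h1
    have h2 : ‖s • L‖ ≤ U := by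
      rw [norm_smul, Real.norm_of_nonneg hs.1]
      exact (mul_le_of_le_one_left (norm_nonneg _) hs.2).trans (hU L hL)
    calc _ ≤ _ := h1
      _ ≤ U * (τ / (U + 2)) + 2 * (τ / (U + 2)) := by
        gcongr
        exact hsmall j
      _ = τ := by field_simp
  have hlog : ∀ j, ‖fun L : F => Complex.log (charFunDual (ν j) L)‖ ≤ δ := by
    intro j
    rw [pi_norm_le_iff_of_nonneg hδ.le]
    intro L
    have h1 := hclose L L.2 j 1 (by simp)
    rw [one_smul] at h1
    have h2 := Complex.norm_log_one_add_half_le_self (h1.trans (min_le_left _ _))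
    rw [add_sub_cancel] at h2
    have h3 : τ ≤ δ / 2 := min_le_right _ _
    linarith
  have hk1 : (k : ℝ)⁻¹ ∈ Icc (0 : ℝ) 1 :=
    ⟨by positivity, inv_le_one_of_one_le₀ (by exact_mod_cast hk)⟩
  obtain ⟨S, hS⟩ := exists_finset_norm_sum_sub_smul_sum_le
    (fun j => fun L : F => Complex.log (charFunDual (ν j) L)) hδ.le hlog hk1
  refine ⟨m, ν, S, hprob, hprod, fun L hL j s hs => (hclose L hL j s hs).trans_lt
    ((min_le_left _ _).trans_lt (by norm_num)), fun L hL => ?_⟩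
  have h1 := (norm_le_pi_norm _ (⟨L, hL⟩ : F)).trans (hS.trans hDδ)
  simpa [Finset.sum_apply] using h1

lemma norm_pow_sub_le_of_exp {z w a b : ℂ} {k : ℕ} {η : ℝ} (hk : 0 < k) (ha : Complex.exp a = z)
    (hb : Complex.exp b = w) (hw : ‖w‖ ≤ 1) (hη : η ≤ 1)
    (h : ‖a - (k : ℝ)⁻¹ • b‖ ≤ η / (2 * k)) : ‖z ^ k - w‖ ≤ η := by
  have hk' : (0 : ℝ) < k := by exact_mod_cast hk
  have hkc : (k : ℂ) ≠ 0 := by exact_mod_cast hk.ne'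
  have h1 : ‖k * a - b‖ ≤ η / 2 := by
    have : k * a - b = (k : ℂ) * (a - (k : ℝ)⁻¹ • b) := by
      rw [Complex.real_smul]; push_cast; field_simp
    rw [this, norm_mul, Complex.norm_natCast]
    calc _ ≤ k * (η / (2 * k)) := by gcongr
      _ = η / 2 := by field_simp
  have h2 : z ^ k - w = w * (Complex.exp (k * a - b) - 1) := by
    rw [← ha, ← hb, ← Complex.exp_nat_mul, mul_sub, ← Complex.exp_add]
    congr 2 <;> ring
  rw [h2, norm_mul]
  have h3 := Complex.norm_exp_sub_one_le (h1.trans (by linarith))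
  have h4 : ‖Complex.exp (k * a - b) - 1‖ ≤ η := by linarith
  exact (mul_le_of_le_one_left (norm_nonneg _) hw).trans h4

lemma IsNullDecomposable.exists_isCompact_approx_root {n : ℕ} {μ : Measure (Fin n → ℝ)}
    [IsProbabilityMeasure μ] (hμ : IsNullDecomposable μ) {k : ℕ} (hk : 0 < k) :
    ∃ K : Set (ProbabilityMeasure (Fin n → ℝ)), IsCompact K ∧
      ∀ (F : Finset (StrongDual ℝ (Fin n → ℝ))) (η : ℝ), 0 < η →
        ∃ ν ∈ K, ∀ L ∈ F, ‖charFunDual (ν : Measure (Fin n → ℝ)) L ^ k - charFunDual μ L‖ ≤ η := by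
  classical
  let u : ℕ → ℝ := fun p => 1 / ((p : ℝ) + 4)
  have hu0 : ∀ p, 0 < u p := fun p => by positivity
  have hu4 : ∀ p, u p ≤ 1 / 4 := fun p =>
    one_div_le_one_div_of_le (by norm_num) (by linarith [(Nat.cast_nonneg p : (0 : ℝ) ≤ p)])
  obtain ⟨R, hR⟩ := exists_radii_measureReal_compl_closedBall_le μ hu0
  have hR0 : 0 ≤ R 0 := (hR 0).1
  set t : ℝ := 1 / (6 * R 0 + 1) with ht
  have ht0 : 0 < t := by positivity
  have htR : t * (3 * R 0) < 1 / 2 := by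
    rw [ht, one_div_mul_eq_div, div_lt_iff₀ (by positivity)]
    linarith
  let L₀ : Fin n → StrongDual ℝ (Fin n → ℝ) := fun i => t • ContinuousLinearMap.proj i
  have hL₀ : ∀ i, ∀ s ∈ Icc (0 : ℝ) 1, ‖s • L₀ i‖ ≤ t := by
    intro i s hs
    refine ContinuousLinearMap.opNorm_le_bound _ ht0.le fun x => ?_
    have h1 : ‖(s • L₀ i) x‖ = s * (t * ‖x i‖) := by
      simp [L₀, abs_of_nonneg hs.1, abs_of_pos ht0]
    rw [h1]
    calc s * (t * ‖x i‖) ≤ 1 * (t * ‖x‖) := by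
          gcongr
          · exact hs.2
          · exact norm_le_pi_norm x i
      _ = t * ‖x‖ := one_mul _
  have hnear : ∀ (κ : Measure (Fin n → ℝ)) [IsProbabilityMeasure κ] (c : Fin n → ℝ),
      κ.real (Metric.closedBall c (3 * R 0))ᶜ ≤ u 0 → ∀ i, ∀ s ∈ Icc (0 : ℝ) 1,
      ‖charFunDual κ (s • L₀ i) * Complex.exp (-(((s • L₀ i) c : ℝ) * Complex.I)) - 1‖ < 1 := by
    intro κ _ c hκ i s hs
    have h1 := norm_charFunDual_mul_exp_sub_one_le κ (s • L₀ i) c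
      (show 0 ≤ 3 * R 0 by positivity)
    have h2 : ‖s • L₀ i‖ * (3 * R 0) ≤ t * (3 * R 0) := by
      gcongr
      exact hL₀ i s hs
    have h3 := hκ.trans (hu4 0)
    linarith
  let r : ℕ → ℝ := fun p => R 0 + 2 * R p + 5 / t
  refine ⟨{ν | ∀ p, ν (Metric.closedBall 0 (r p))ᶜ ≤ (u p).toNNReal},
    isCompact_setOfPred_probabilityMeasure_mass_eq_compl_isCompact_le ?_
      (fun p => isCompact_closedBall _ _) (Or.inl inferInstance), fun F η hη => ?_⟩
  · have : Tendsto u atTop (𝓝 0) := by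
      have h4 := (tendsto_one_div_add_atTop_nhds_zero_nat (𝕜 := ℝ)).comp (tendsto_add_atTop_nat 3)
      refine h4.congr fun p => ?_
      simp only [Function.comp, u]; push_cast; ring
    simpa [Function.comp_def] using (continuous_real_toNNReal.tendsto 0).comp this
  set η' : ℝ := min η 1 with hη'
  have hη'0 : 0 < η' := by positivity
  have hk' : (1 : ℝ) ≤ k := by exact_mod_cast hk
  obtain ⟨m, ν, S, hprob, hprod, hlt, happrox⟩ :=
    hμ.exists_factor hk (F ∪ Finset.univ.image L₀) (η := η' / (2 * k)) (by positivity)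
  have hS := isProbabilityMeasure_sumLaw ν S
  have hSc := isProbabilityMeasure_sumLaw ν Sᶜ
  have hconv : sumLaw ν Sᶜ ∗ sumLaw ν S = μ := by
    refine Measure.ext_of_charFunDual (funext fun L => ?_)
    rw [charFunDual_conv, charFunDual_sumLaw, charFunDual_sumLaw, hprod,
      Finset.prod_compl_mul_prod]
  obtain ⟨c, hc⟩ := exists_center_of_conv_eq hconv
    (fun p => (hu4 p).trans_lt (by norm_num)) (fun p => (hR p).2)
  have hci : ∀ i, |c i| ≤ 5 / t := by
    intro i
    have hLi : L₀ i ∈ F ∪ Finset.univ.image L₀ := by simp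
    have h1 := abs_im_sum_log_sub_le (c := c) (charFunDual_sumLaw ν S) (hlt _ hLi)
      (hnear _ c (by simpa only [show R 0 + 2 * R 0 = 3 * R 0 by ring] using hc 0) i)
    have h2 := abs_im_sum_log_sub_le (c := 0) hprod (hlt _ hLi)
      (hnear μ 0 ((measureReal_mono (Set.compl_subset_compl.2
        (Metric.closedBall_subset_closedBall (by linarith)))).trans (hR 0).2) i)
    have h3 := (Complex.abs_im_le_norm _).trans (happrox _ hLi)
    have h4 : η' / (2 * k) ≤ 1 / 2 := by
      rw [div_le_div_iff₀ (by positivity) (by norm_num)]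
      nlinarith [min_le_right η 1]
    rw [Complex.sub_im, Complex.smul_im, smul_eq_mul] at h3
    rw [map_zero, sub_zero] at h2
    have h5 : |(k : ℝ)⁻¹ * (∑ j, Complex.log (charFunDual (ν j) (L₀ i))).im| ≤ Real.pi / 2 := by
      rw [abs_mul, abs_of_nonneg (by positivity)]
      exact (mul_le_of_le_one_left (abs_nonneg _) (inv_le_one_of_one_le₀ hk')).trans h2
    have h6 : |L₀ i c| ≤ 5 := by
      rw [abs_le] at *
      have := Real.pi_lt_d2
      constructor <;> linarith
    have h7 : L₀ i c = t * c i := by simp [L₀]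
    rw [h7, abs_mul, abs_of_pos ht0] at h6
    rwa [le_div_iff₀ ht0, mul_comm]
  have hcn : ‖c‖ ≤ 5 / t := (pi_norm_le_iff_of_nonneg (by positivity)).2 hci
  refine ⟨⟨sumLaw ν S, hS⟩, fun p => ?_, fun L hL => ?_⟩
  · have h1 : (sumLaw ν S).real (Metric.closedBall 0 (r p))ᶜ ≤ u p := by
      refine (measureReal_mono (Set.compl_subset_compl.2 ?_)).trans (hc p)
      refine Metric.closedBall_subset_closedBall' ?_
      rw [dist_zero_right]
      simp only [r]; linarith
    exact NNReal.le_toNNReal_of_coe_le h1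
  · have hLF : L ∈ F ∪ Finset.univ.image L₀ := Finset.mem_union_left _ hL
    have hne : ∀ j, charFunDual (ν j) L ≠ 0 := by
      intro j h0
      have := hlt L hLF j 1 (by simp)
      simp [h0] at this
    refine (norm_pow_sub_le_of_exp hk (a := ∑ j ∈ S, Complex.log (charFunDual (ν j) L))
      (b := ∑ j, Complex.log (charFunDual (ν j) L)) ?_ ?_ ?_ (min_le_right η 1)
      (happrox L hLF)).trans (min_le_left _ _)
    · simp only [ProbabilityMeasure.coe_mk, charFunDual_sumLaw, Complex.exp_sum,
        Complex.exp_log (hne _)]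
    · simp only [hprod, Complex.exp_sum, Complex.exp_log (hne _)]
    · rw [charFunDual_eq_charFun_map_one]
      have := Measure.isProbabilityMeasure_map (μ := μ) (f := L) (by fun_prop)
      exact norm_charFun_le_one _

theorem IsNullDecomposable.isInfinitelyDivisible {n : ℕ} {μ : Measure (Fin n → ℝ)}
    [IsProbabilityMeasure μ] (hμ : IsNullDecomposable μ) : IsInfinitelyDivisible μ := by
  classical
  intro k hk
  obtain ⟨K, hK, happrox⟩ := hμ.exists_isCompact_approx_root hk
  obtain ⟨ν, -, hν⟩ := hK.inter_iInter_nonempty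
    (fun q : StrongDual ℝ (Fin n → ℝ) × {η : ℝ // 0 < η} =>
      {ν | ‖charFunDual (ν : Measure (Fin n → ℝ)) q.1 ^ k - charFunDual μ q.1‖ ≤ q.2})
    (fun q => isClosed_le (((continuous_charFunDual_probabilityMeasure q.1).pow k).sub
      continuous_const).norm continuous_const)
    (fun T => by
      obtain ⟨η, hη, hηT⟩ : ∃ η : ℝ, 0 < η ∧ ∀ q ∈ T, η ≤ (q.2 : ℝ) := by
        induction T using Finset.induction_on with
        | empty => exact ⟨1, one_pos, by simp⟩
        | insert q T _ ih =>
          obtain ⟨η, hη, h⟩ := ih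
          refine ⟨min η q.2, lt_min hη q.2.2, fun q' hq' => ?_⟩
          rcases Finset.mem_insert.1 hq' with rfl | hq'
          · exact min_le_right _ _
          · exact (min_le_left _ _).trans (h q' hq')
      obtain ⟨ν, hνK, hν⟩ := happrox (T.image Prod.fst) η hη
      refine ⟨ν, hνK, Set.mem_iInter₂.2 fun q hq => ?_⟩
      exact (hν q.1 (Finset.mem_image_of_mem _ hq)).trans (hηT q hq))
  refine ⟨ν, inferInstance, ?_⟩
  obtain ⟨hprob, hchar⟩ := charFunDual_iterate_conv (ν : Measure (Fin n → ℝ)) k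
  refine Measure.ext_of_charFunDual (funext fun L => ?_)
  rw [hchar]
  refine (sub_eq_zero.1 (norm_le_zero_iff.1 (le_of_forall_gt_imp_ge_of_dense fun η hη => ?_))).symm
  exact Set.mem_iInter.1 hν (L, ⟨η, hη⟩)

lemma continuous_charFun_real (ν : Measure ℝ) [IsFiniteMeasure ν] : Continuous (charFun ν) := by
  have h : charFun ν = fun t : ℝ => charFunDual ν (t • InnerProductSpace.toDualMap ℝ ℝ 1) := by
    ext t
    rw [charFun_eq_charFunDual_toDualMap]
    congr 1
    ext
    simp
  rw [h]
  exact continuous_charFunDual_smul ν _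

lemma one_sub_re_charFun_two_mul_le (ν : Measure ℝ) [IsProbabilityMeasure ν] (t : ℝ) :
    1 - (charFun ν (2 * t)).re ≤ 4 * (1 - (charFun ν t).re) := by
  have hre : ∀ s : ℝ, (charFun ν s).re = ∫ y, Real.cos (s * y) ∂ν := by
    intro s
    have hint : Integrable (fun y : ℝ => Complex.exp (s * y * Complex.I)) ν :=
      Integrable.of_bound (by fun_prop) 1 (Eventually.of_forall fun y => by
        rw [← Complex.ofReal_mul, Complex.norm_exp_ofReal_mul_I])
    rw [charFun_apply_real, ← RCLike.re_eq_complex_re, ← integral_re hint]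
    refine integral_congr_ae (Eventually.of_forall fun y => ?_)
    simp only [RCLike.re_eq_complex_re]
    rw [← Complex.ofReal_mul, Complex.exp_ofReal_mul_I_re]
  have hint : ∀ s : ℝ, Integrable (fun y => Real.cos (s * y)) ν := fun s =>
    Integrable.of_bound (by fun_prop) 1 (Eventually.of_forall fun y => Real.abs_cos_le_one _)
  have hone : ∀ s : ℝ, 1 - (charFun ν s).re = ∫ y, (1 - Real.cos (s * y)) ∂ν := by
    intro s
    rw [integral_sub (integrable_const _) (hint s), hre]
    simp
  rw [hone, hone, ← integral_const_mul]
  refine integral_mono ((integrable_const _).sub (hint _))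
    (((integrable_const _).sub (hint _)).const_mul _) fun y => ?_
  simp only [mul_assoc, Real.cos_two_mul]
  nlinarith [sq_nonneg (Real.cos (t * y) - 1)]

lemma norm_sub_one_sq_le_of_norm_le_one {z : ℂ} (hz : ‖z‖ ≤ 1) :
    ‖z - 1‖ ^ 2 ≤ 2 * (1 - z.re) := by
  have h1 : ‖z‖ ^ 2 ≤ 1 := pow_le_one₀ (norm_nonneg _) hz
  rw [← Complex.normSq_eq_norm_sq, Complex.normSq_apply] at *
  simp only [Complex.sub_re, Complex.sub_im, Complex.one_re, Complex.one_im]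
  nlinarith

/-- Convergence of characteristic functions to one near the origin already forces convergence in
probability to zero. -/
lemma tendsto_measureReal_compl_closedBall_of_charFun {ν : ℕ → Measure ℝ}
    [∀ m, IsProbabilityMeasure (ν m)] {t₀ : ℝ} (ht₀ : 0 < t₀)
    (h : ∀ t, |t| ≤ t₀ → Tendsto (fun m => charFun (ν m) t) atTop (𝓝 1)) {ρ : ℝ} (hρ : 0 < ρ) :
    Tendsto (fun m => (ν m).real (Metric.closedBall 0 ρ)ᶜ) atTop (𝓝 0) := by
  have hre : ∀ (p : ℕ) (t : ℝ), |t| ≤ t₀ →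
      Tendsto (fun m => 1 - (charFun (ν m) (2 ^ p * t)).re) atTop (𝓝 0) := by
    intro p t ht
    induction p with
    | zero =>
      have := ((Complex.continuous_re.tendsto 1).comp (h t ht)).const_sub 1
      simpa [Function.comp_def] using this
    | succ p ih =>
      refine squeeze_zero (fun m => ?_) (fun m => ?_) (by simpa using ih.const_mul 4)
      · linarith [Complex.re_le_norm (charFun (ν m) (2 ^ (p + 1) * t)),
          norm_charFun_le_one (μ := ν m) (2 ^ (p + 1) * t)]
      · rw [pow_succ', mul_assoc]
        exact one_sub_re_charFun_two_mul_le _ _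
  have hall : ∀ t, Tendsto (fun m => charFun (ν m) t) atTop (𝓝 1) := by
    intro t
    obtain ⟨p, hp⟩ := pow_unbounded_of_one_lt (|t| / t₀) (one_lt_two)
    have ht : |t / 2 ^ p| ≤ t₀ := by
      rw [abs_div, abs_of_pos (by positivity : (0 : ℝ) < 2 ^ p), div_le_iff₀ (by positivity)]
      rw [div_lt_iff₀ ht₀] at hp
      linarith
    have h1 := hre p _ ht
    rw [mul_div_cancel₀ _ (by positivity)] at h1
    rw [tendsto_iff_norm_sub_tendsto_zero]
    have h2 : Tendsto (fun m => ‖charFun (ν m) t - 1‖ ^ 2) atTop (𝓝 0) :=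
      squeeze_zero (fun m => by positivity)
        (fun m => norm_sub_one_sq_le_of_norm_le_one (norm_charFun_le_one t))
        (by simpa using h1.const_mul 2)
    have h3 := (Real.continuous_sqrt.tendsto 0).comp h2
    simpa [Function.comp_def, Real.sqrt_sq] using h3
  let κ : ℕ → ProbabilityMeasure ℝ := fun m => ⟨ν m, inferInstance⟩
  let κ₀ : ProbabilityMeasure ℝ := ⟨Measure.dirac 0, inferInstance⟩
  have hκ : Tendsto κ atTop (𝓝 κ₀) := by
    rw [ProbabilityMeasure.tendsto_iff_tendsto_charFun]
    intro t
    simpa [κ, κ₀, charFun_dirac] using hall t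
  have h0 : (κ₀ : Measure ℝ) (frontier (Metric.closedBall 0 ρ)ᶜ) = 0 := by
    rw [frontier_compl, frontier_closedBall _ hρ.ne']
    simp [κ₀, Measure.dirac_apply, hρ.ne]
  have h1 := ProbabilityMeasure.tendsto_measure_of_null_frontier_of_tendsto' hκ h0
  have h2 : (κ₀ : Measure ℝ) (Metric.closedBall 0 ρ)ᶜ = 0 := by
    simp [κ₀, Measure.dirac_apply, hρ.le]
  rw [h2] at h1
  exact (ENNReal.tendsto_toReal ENNReal.zero_ne_top).comp h1

/-- Factors of a continuous multiplicative flow: if `φ` is continuous on `[ε, 1]` and bounded away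
from zero, then the ratios of consecutive values along `ε ^ (j / (m + 1))` tend to one. -/
lemma tendsto_ratio_of_continuousOn {φ : ℝ → ℂ} {ε : ℝ} (hε : ε ∈ Ioc (0 : ℝ) 1)
    (hφ : ContinuousOn φ (Icc ε 1)) {b : ℝ} (hb : 0 < b) (hlow : ∀ r ∈ Icc ε 1, b ≤ ‖φ r‖)
    {J : ℕ → ℕ} (hJ : ∀ m, J m ≤ m) {ψ : ℕ → ℂ}
    (hψ : ∀ m : ℕ, φ ((ε ^ (1 / ((m : ℝ) + 1))) ^ (J m + 1)) =
      φ ((ε ^ (1 / ((m : ℝ) + 1))) ^ J m) * ψ m) :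
    Tendsto ψ atTop (𝓝 1) := by
  have hδ1 : ∀ m : ℕ, ε ^ (1 / ((m : ℝ) + 1)) ≤ 1 := fun m =>
    Real.rpow_le_one hε.1.le hε.2 (by positivity)
  have hδ0 : ∀ m : ℕ, 0 < ε ^ (1 / ((m : ℝ) + 1)) := fun m => Real.rpow_pos_of_pos hε.1 _
  have hδε : ∀ m : ℕ, (ε ^ (1 / ((m : ℝ) + 1))) ^ (m + 1) = ε := fun m => by
    rw [← Real.rpow_natCast, ← Real.rpow_mul hε.1.le]
    push_cast
    rw [one_div_mul_cancel (by positivity), Real.rpow_one]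
  have hmem : ∀ m j : ℕ, j ≤ m + 1 → (ε ^ (1 / ((m : ℝ) + 1))) ^ j ∈ Icc ε 1 := fun m j hj =>
    ⟨(hδε m).symm.le.trans (pow_le_pow_of_le_one (hδ0 m).le (hδ1 m) hj),
      pow_le_one₀ (hδ0 m).le (hδ1 m)⟩
  have hlim : Tendsto (fun m : ℕ => ε ^ (1 / ((m : ℝ) + 1))) atTop (𝓝 1) := by
    have h1 := ((Real.continuousAt_const_rpow hε.1.ne' (b := 0)).tendsto).comp
      (tendsto_one_div_add_atTop_nhds_zero_nat (𝕜 := ℝ))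
    simpa [Function.comp_def] using h1
  have huc := Metric.uniformContinuousOn_iff.1 (isCompact_Icc.uniformContinuousOn_of_continuous hφ)
  rw [Metric.tendsto_atTop']
  intro e he
  obtain ⟨d, hd, hdist⟩ := huc (b * e) (by positivity)
  obtain ⟨N, hN⟩ := Metric.tendsto_atTop'.1 hlim d hd
  refine ⟨N, fun m hm => ?_⟩
  have h1 := hmem m (J m) ((hJ m).trans (Nat.le_succ m))
  have h2 := hdist _ (hmem m (J m + 1) (Nat.succ_le_succ (hJ m))) _ h1 ?_
  · rw [hψ, dist_eq_norm, ← mul_sub_one, norm_mul] at h2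
    rw [dist_eq_norm]
    have h3 := hlow _ h1
    by_contra! hcon
    nlinarith [mul_le_mul h3 hcon he.le (norm_nonneg _)]
  · refine lt_of_le_of_lt ?_ (hN m hm)
    rw [pow_succ, dist_eq_norm, dist_eq_norm, ← mul_sub_one, norm_mul]
    refine mul_le_of_le_one_left (norm_nonneg _) ?_
    rw [Real.norm_of_nonneg (pow_nonneg (hδ0 m).le _)]
    exact h1.2

lemma continuousOn_charFun_map {Ω X : Type*} [MeasurableSpace Ω] {P : Measure Ω}
    [IsProbabilityMeasure P] {W : ℝ → X → Ω → ℝ} (hmeas : ∀ ε x, Measurable (W ε x)) {x : X}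
    {s : Set ℝ}
    (hcont : ∀ f : BoundedContinuousFunction ℝ ℝ,
      ContinuousOn (fun ε => ∫ ω, f (W ε x ω) ∂P) s) (t : ℝ) :
    ContinuousOn (fun ε => charFun (P.map (W ε x)) t) s := by
  have hp : ∀ ε, IsProbabilityMeasure (P.map (W ε x)) := fun ε =>
    Measure.isProbabilityMeasure_map (hmeas ε x).aemeasurable
  let κ : ℝ → ProbabilityMeasure ℝ := fun ε => ⟨P.map (W ε x), hp ε⟩
  have hκ : ContinuousOn κ s := fun ε hε => by
    refine ProbabilityMeasure.tendsto_iff_forall_integral_tendsto.2 fun f => ?_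
    have h1 : ∀ ε, ∫ y, f y ∂(κ ε : Measure ℝ) = ∫ ω, f (W ε x ω) ∂P := fun ε =>
      integral_map (hmeas ε x).aemeasurable f.continuous.aestronglyMeasurable
    simp only [h1]
    exact hcont f ε hε
  simp only [charFun_eq_charFunDual_toDualMap]
  exact (continuous_charFunDual_probabilityMeasure _).comp_continuousOn hκ

section Cascade

variable {Ω : Type*} [MeasurableSpace Ω] {P : Measure Ω} [IsProbabilityMeasure P]
    {X : Type*} [AddCommGroup X] [Module ℝ X] {W : ℝ → X → Ω → ℝ}

lemma map_eq_conv_of_cascade (hmeas : ∀ ε x, Measurable (W ε x))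
    (hcascade : ∀ ε ∈ Set.Ioc (0 : ℝ) 1, ∀ ε' ∈ Set.Ioc (0 : ℝ) 1, ∀ (n : ℕ) (x : Fin n → X),
      Measure.map (fun ω i => W (ε * ε') (x i) ω) P =
        Measure.map (fun (ω : Ω × Ω) i => W ε (x i) ω.1 + W ε' (ε⁻¹ • x i) ω.2) (P.prod P))
    {ε ε' : ℝ} (hε : ε ∈ Set.Ioc (0 : ℝ) 1) (hε' : ε' ∈ Set.Ioc (0 : ℝ) 1) {n : ℕ}
    (x : Fin n → X) :
    Measure.map (fun ω i => W (ε * ε') (x i) ω) P =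
      Measure.map (fun ω i => W ε (x i) ω) P ∗ Measure.map (fun ω i => W ε' (ε⁻¹ • x i) ω) P := by
  have h1 : Measurable fun ω i => W ε (x i) ω := measurable_pi_lambda _ fun i => hmeas _ _
  have h2 : Measurable fun ω i => W ε' (ε⁻¹ • x i) ω := measurable_pi_lambda _ fun i => hmeas _ _
  rw [hcascade ε hε ε' hε' n x, Measure.conv, Measure.map_prod_map _ _ h1 h2,
    Measure.map_map (by fun_prop) (by fun_prop)]
  rfl

lemma map_eval_eq_conv_of_cascade (hmeas : ∀ ε x, Measurable (W ε x))
    (hcascade : ∀ ε ∈ Set.Ioc (0 : ℝ) 1, ∀ ε' ∈ Set.Ioc (0 : ℝ) 1, ∀ (n : ℕ) (x : Fin n → X),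
      Measure.map (fun ω i => W (ε * ε') (x i) ω) P =
        Measure.map (fun (ω : Ω × Ω) i => W ε (x i) ω.1 + W ε' (ε⁻¹ • x i) ω.2) (P.prod P))
    {ε ε' : ℝ} (hε : ε ∈ Set.Ioc (0 : ℝ) 1) (hε' : ε' ∈ Set.Ioc (0 : ℝ) 1) (x : X) :
    P.map (W (ε * ε') x) = P.map (W ε x) ∗ P.map (W ε' (ε⁻¹ • x)) := by
  have h := congrArg (Measure.map (fun y : Fin 1 → ℝ => y 0))
    (hcascade ε hε ε' hε' 1 fun _ => x)
  have h3 : Measurable fun (ω : Ω × Ω) (_ : Fin 1) => W ε x ω.1 + W ε' (ε⁻¹ • x) ω.2 :=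
    measurable_pi_lambda _ fun i =>
      ((hmeas _ _).comp measurable_fst).add ((hmeas _ _).comp measurable_snd)
  rw [Measure.map_map (by fun_prop) (measurable_pi_lambda _ fun i => hmeas _ _),
    Measure.map_map (by fun_prop) h3] at h
  rw [Measure.conv, Measure.map_prod_map _ _ (hmeas _ _) (hmeas _ _),
    Measure.map_map (by fun_prop) (by fun_prop)]
  exact h

lemma tendsto_measureReal_increment_of_cascade (hmeas : ∀ ε x, Measurable (W ε x))
    (hcascade : ∀ ε ∈ Set.Ioc (0 : ℝ) 1, ∀ ε' ∈ Set.Ioc (0 : ℝ) 1, ∀ (n : ℕ) (x : Fin n → X),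
      Measure.map (fun ω i => W (ε * ε') (x i) ω) P =
        Measure.map (fun (ω : Ω × Ω) i => W ε (x i) ω.1 + W ε' (ε⁻¹ • x i) ω.2) (P.prod P))
    {x : X} (hcont : ∀ f : BoundedContinuousFunction ℝ ℝ,
      ContinuousOn (fun ε => ∫ ω, f (W ε x ω) ∂P) (Set.Ioc (0 : ℝ) 1))
    {ε : ℝ} (hε : ε ∈ Set.Ioc (0 : ℝ) 1) {J : ℕ → ℕ} (hJ : ∀ m, J m ≤ m) {ρ : ℝ} (hρ : 0 < ρ) :
    Tendsto (fun m : ℕ => (P.map (W (ε ^ (1 / ((m : ℝ) + 1)))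
      (((ε ^ (1 / ((m : ℝ) + 1))) ^ J m)⁻¹ • x))).real (Metric.closedBall 0 ρ)ᶜ)
      atTop (𝓝 0) := by
  have hp : ∀ ε x, IsProbabilityMeasure (P.map (W ε x)) := fun ε x =>
    Measure.isProbabilityMeasure_map (hmeas ε x).aemeasurable
  have hchar : ∀ r ∈ Ioc (0 : ℝ) 1, ∀ s ∈ Ioc (0 : ℝ) 1, ∀ t, charFun (P.map (W (r * s) x)) t =
      charFun (P.map (W r x)) t * charFun (P.map (W s (r⁻¹ • x))) t := fun r hr s hs t => by
    rw [map_eval_eq_conv_of_cascade hmeas hcascade hr hs, charFun_conv]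
  have hδ : ∀ m : ℕ, ε ^ (1 / ((m : ℝ) + 1)) ∈ Ioc (0 : ℝ) 1 := fun m =>
    ⟨Real.rpow_pos_of_pos hε.1 _, Real.rpow_le_one hε.1.le hε.2 (by positivity)⟩
  obtain ⟨t₀, ht₀, hball⟩ : ∃ t₀ > 0, ∀ t, |t| ≤ t₀ → 1 / 2 ≤ ‖charFun (P.map (W ε x)) t‖ := by
    have h1 : ∀ᶠ t in 𝓝 (0 : ℝ), 1 / 2 < ‖charFun (P.map (W ε x)) t‖ :=
      (continuous_charFun_real _).norm.continuousAt.eventually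
        (lt_mem_nhds (by simp; norm_num))
    obtain ⟨d, hd, h2⟩ := Metric.eventually_nhds_iff.1 h1
    refine ⟨d / 2, by positivity, fun t ht => (h2 ?_).le⟩
    rw [dist_zero_right, Real.norm_eq_abs]
    linarith
  refine tendsto_measureReal_compl_closedBall_of_charFun ht₀ (fun t ht => ?_) hρ
  refine tendsto_ratio_of_continuousOn (φ := fun r => charFun (P.map (W r x)) t) hε
    ((continuousOn_charFun_map hmeas hcont t).mono (Icc_subset_Ioc hε.1 le_rfl))
    (b := 1 / 2) (by norm_num) (fun r hr => ?_) hJ (fun m => ?_)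
  · have hr0 : 0 < r := hε.1.trans_le hr.1
    have h1 := hchar r ⟨hr0, hr.2⟩ (ε / r)
      ⟨div_pos hε.1 hr0, div_le_one_of_le₀ hr.1 hr0.le⟩ t
    rw [mul_div_cancel₀ _ hr0.ne'] at h1
    refine (hball t ht).trans ?_
    rw [h1, norm_mul]
    exact mul_le_of_le_one_right (norm_nonneg _) (norm_charFun_le_one _)
  · simp only [pow_succ]
    exact hchar _ ⟨pow_pos (hδ m).1 _, pow_le_one₀ (hδ m).1.le (hδ m).2⟩ _ (hδ m) t

lemma charFunDual_map_pow_of_cascade (hmeas : ∀ ε x, Measurable (W ε x))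
    (hcascade : ∀ ε ∈ Set.Ioc (0 : ℝ) 1, ∀ ε' ∈ Set.Ioc (0 : ℝ) 1, ∀ (n : ℕ) (x : Fin n → X),
      Measure.map (fun ω i => W (ε * ε') (x i) ω) P =
        Measure.map (fun (ω : Ω × Ω) i => W ε (x i) ω.1 + W ε' (ε⁻¹ • x i) ω.2) (P.prod P))
    {δ : ℝ} (hδ : δ ∈ Set.Ioc (0 : ℝ) 1) {n : ℕ} (x : Fin n → X) (m : ℕ)
    (L : StrongDual ℝ (Fin n → ℝ)) :
    charFunDual (P.map fun ω i => W (δ ^ (m + 1)) (x i) ω) L =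
      ∏ j : Fin (m + 1), charFunDual (P.map fun ω i => W δ ((δ ^ (j : ℕ))⁻¹ • x i) ω) L := by
  induction m with
  | zero => simp
  | succ m ih =>
    rw [Fin.prod_univ_castSucc, pow_succ, map_eq_conv_of_cascade hmeas hcascade
      ⟨pow_pos hδ.1 _, pow_le_one₀ hδ.1.le hδ.2⟩ hδ, charFunDual_conv, ih]
    rfl

theorem isNullDecomposable_map_of_cascade (hmeas : ∀ ε x, Measurable (W ε x))
    (hcascade : ∀ ε ∈ Set.Ioc (0 : ℝ) 1, ∀ ε' ∈ Set.Ioc (0 : ℝ) 1, ∀ (n : ℕ) (x : Fin n → X),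
      Measure.map (fun ω i => W (ε * ε') (x i) ω) P =
        Measure.map (fun (ω : Ω × Ω) i => W ε (x i) ω.1 + W ε' (ε⁻¹ • x i) ω.2) (P.prod P))
    (hcont : ∀ (x : X) (f : BoundedContinuousFunction ℝ ℝ),
      ContinuousOn (fun ε => ∫ ω, f (W ε x ω) ∂P) (Set.Ioc (0 : ℝ) 1))
    {ε : ℝ} (hε : ε ∈ Set.Ioc (0 : ℝ) 1) {n : ℕ} (x : Fin n → X) :
    IsNullDecomposable (P.map fun ω i => W ε (x i) ω) := by
  classical
  intro ρ hρ
  let δ : ℕ → ℝ := fun m => ε ^ (1 / ((m : ℝ) + 1))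
  have hδ : ∀ m, δ m ∈ Ioc (0 : ℝ) 1 := fun m =>
    ⟨Real.rpow_pos_of_pos hε.1 _, Real.rpow_le_one hε.1.le hε.2 (by positivity)⟩
  have hδε : ∀ m, δ m ^ (m + 1) = ε := fun m => by
    rw [← Real.rpow_natCast, ← Real.rpow_mul hε.1.le]
    push_cast
    rw [one_div_mul_cancel (by positivity), Real.rpow_one]
  have hev : ∀ i, ∀ᶠ m in atTop, ∀ j ≤ m, (P.map (W (δ m) ((δ m ^ j)⁻¹ • x i))).real
      (Metric.closedBall 0 ρ)ᶜ ≤ ρ / (n + 1) := by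
    intro i
    have hJ : ∀ m, ∃ J ≤ m, ∀ j ≤ m, (P.map (W (δ m) ((δ m ^ j)⁻¹ • x i))).real
        (Metric.closedBall 0 ρ)ᶜ ≤ (P.map (W (δ m) ((δ m ^ J)⁻¹ • x i))).real
        (Metric.closedBall 0 ρ)ᶜ := fun m => by
      obtain ⟨J, hJm, hJ⟩ := Finset.exists_max_image (Finset.range (m + 1))
        (fun j => (P.map (W (δ m) ((δ m ^ j)⁻¹ • x i))).real (Metric.closedBall 0 ρ)ᶜ) (by simp)
      exact ⟨J, by simpa [Nat.lt_succ_iff] using hJm, fun j hj => hJ j (by simpa [Nat.lt_succ_iff])⟩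
    choose J hJm hJ using hJ
    have h1 := tendsto_measureReal_increment_of_cascade hmeas hcascade (hcont (x i)) hε hJm hρ
    filter_upwards [h1.eventually_le_const (show 0 < ρ / (n + 1) by positivity)] with m hm j hj
    exact (hJ m j hj).trans hm
  obtain ⟨m, hm⟩ := (eventually_all.2 hev).exists
  refine ⟨m + 1, fun j => P.map fun ω i => W (δ m) ((δ m ^ (j : ℕ))⁻¹ • x i) ω, fun j => ?_,
    fun j => ?_, fun L => ?_⟩
  · exact Measure.isProbabilityMeasure_map
      (measurable_pi_lambda _ fun i => hmeas _ _).aemeasurable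
  · have hms : MeasurableSet (Metric.closedBall (0 : ℝ) ρ)ᶜ :=
      Metric.isClosed_closedBall.measurableSet.compl
    have hmsn : MeasurableSet (Metric.closedBall (0 : Fin n → ℝ) ρ)ᶜ :=
      Metric.isClosed_closedBall.measurableSet.compl
    rw [map_measureReal_apply (measurable_pi_lambda _ fun i => hmeas _ _) hmsn]
    have hsub : (fun ω i => W (δ m) ((δ m ^ (j : ℕ))⁻¹ • x i) ω) ⁻¹'
        (Metric.closedBall (0 : Fin n → ℝ) ρ)ᶜ ⊆
        ⋃ i, W (δ m) ((δ m ^ (j : ℕ))⁻¹ • x i) ⁻¹' (Metric.closedBall (0 : ℝ) ρ)ᶜ := by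
      intro ω hω
      simp only [Set.mem_preimage, Set.mem_compl_iff, Metric.mem_closedBall, dist_zero_right,
        pi_norm_le_iff_of_nonneg hρ.le, not_forall] at hω
      simpa using hω
    calc _ ≤ _ := measureReal_mono hsub
      _ ≤ _ := measureReal_iUnion_fintype_le _
      _ ≤ ∑ _i : Fin n, ρ / (n + 1) := Finset.sum_le_sum fun i _ => by
          rw [← map_measureReal_apply (hmeas _ _) hms]
          exact hm i j (Nat.lt_succ_iff.1 j.2)
      _ ≤ ρ := by
          rw [Finset.sum_const, Finset.card_univ, Fintype.card_fin, nsmul_eq_mul,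
            ← mul_div_assoc, div_le_iff₀ (by positivity)]
          nlinarith
  · rw [← charFunDual_map_pow_of_cascade hmeas hcascade (hδ m), hδε]

end Cascade


/-- Lemma 1 (key part): if the family `(ω_ε)` of stationary stochastically continuous
processes satisfies the cascading rule
`ω_{εε'} = ω_ε + ω̃_{ε'}(·/ε)` in law (with `ω̃_{ε'}` an independent copy of `ω_{ε'}`)
and `ε ↦ ω_ε(x)` is continuous in distribution, then all finite-dimensional marginals
of `ω_ε` are infinitely divisible. -/
theorem stmt_9 {Ω : Type*} [MeasurableSpace Ω] (P : Measure Ω) [IsProbabilityMeasure P]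
    (d : ℕ) (W : ℝ → EuclideanSpace ℝ (Fin d) → Ω → ℝ)
    (hmeas : ∀ ε x, Measurable (W ε x))
    (hcascade : ∀ ε ∈ Set.Ioc (0 : ℝ) 1, ∀ ε' ∈ Set.Ioc (0 : ℝ) 1,
      ∀ (n : ℕ) (x : Fin n → EuclideanSpace ℝ (Fin d)),
      Measure.map (fun ω i => W (ε * ε') (x i) ω) P =
        Measure.map (fun (ω : Ω × Ω) i => W ε (x i) ω.1 + W ε' (ε⁻¹ • x i) ω.2)
          (P.prod P))
    (hcont : ∀ (x : EuclideanSpace ℝ (Fin d)) (f : BoundedContinuousFunction ℝ ℝ),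
      ContinuousOn (fun ε => ∫ ω, f (W ε x ω) ∂P) (Set.Ioc (0 : ℝ) 1)) :
    ∀ ε ∈ Set.Ioc (0 : ℝ) 1, ∀ (n : ℕ) (x : Fin n → EuclideanSpace ℝ (Fin d)),
      IsInfinitelyDivisible (Measure.map (fun ω i => W ε (x i) ω) P) := by
  intro ε hε n x
  have : IsProbabilityMeasure (Measure.map (fun ω i => W ε (x i) ω) P) :=
    Measure.isProbabilityMeasure_map (measurable_pi_lambda _ fun i => hmeas _ _).aemeasurable
  exact (isNullDecomposable_map_of_cascade hmeas hcascade hcont hε x).isInfinitelyDivisible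
end
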